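/- arXiv:2506.17000 — 4 statements merged into one kernel-verified Lean document; each statement's English description precedes it below -/
import Mathlib

section
/- Let u : Ω → [−1,1] be a minimizer of J with u(0) = 0. Then for every h ∈ (0,1) there exists ρ = ρ(n,p,m,λ,Λ,h) > 0 such that, whenever B_{2ρ} ⊆ Ω, one has sup_{B_ρ} u ≥ 1 − h. -/
open MeasureTheory Metric Set

noncomputable section

/-- `v` is locally Lipschitz at every point of `Ω`. -/
def LocLipOn {n : ℕ} (Ω : Set (EuclideanSpace ℝ (Fin n)))
    (v : EuclideanSpace ℝ (Fin n) → ℝ) : Prop :=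
  ∀ x ∈ Ω, ∃ K : NNReal, ∃ U ∈ nhds x, LipschitzOnWith K v U

/-- The energy `J(v,A) = ∫_A (|∇v|^p + W(v)) dx`. -/
def JW {n : ℕ} (p : ℝ) (W : ℝ → ℝ) (v : EuclideanSpace ℝ (Fin n) → ℝ)
    (A : Set (EuclideanSpace ℝ (Fin n))) : ℝ :=
  ∫ x in A, (‖gradient v x‖ ^ p + W (v x))

/-- `u` minimizes `JW p W` in `Ω` among `[-1,1]`-valued locally Lipschitz competitors. -/
def IsMinOfJW {n : ℕ} (p : ℝ) (W : ℝ → ℝ) (Ω : Set (EuclideanSpace ℝ (Fin n)))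
    (u : EuclideanSpace ℝ (Fin n) → ℝ) : Prop :=
  ∀ Ω' : Set (EuclideanSpace ℝ (Fin n)), IsOpen Ω' → Bornology.IsBounded Ω' →
    closure Ω' ⊆ Ω →
    ∀ v : EuclideanSpace ℝ (Fin n) → ℝ,
      (∀ x, v x ∈ Icc (-1 : ℝ) 1) → LocLipOn Ω v →
      (∀ x ∈ Ω \ Ω', v x = u x) →
      JW p W u Ω' ≤ JW p W v Ω'

/-- The structural assumptions on the double-well potential `W`
(as in Theorem 3.1 of the paper). -/
def IsAdmissiblePotential (m lam Lam : ℝ) (W : ℝ → ℝ) : Prop :=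
  ContDiffOn ℝ 1 W (Ioo (-1 : ℝ) 1) ∧
  (∀ τ ∈ Ioo (-1 : ℝ) 1, 0 < W τ) ∧
  (∀ τ ∈ Ioo (-1 : ℝ) 1,
    lam ≤ W τ / (1 - τ ^ 2) ^ m ∧ W τ / (1 - τ ^ 2) ^ m ≤ Lam) ∧
  (∀ τ : ℝ, 1 / 2 < |τ| → |τ| < 1 →
    lam ≤ -(deriv W τ) * Real.sign τ / (1 - τ ^ 2) ^ (m - 1) ∧
    -(deriv W τ) * Real.sign τ / (1 - τ ^ 2) ^ (m - 1) ≤ Lam) ∧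
  W (-1) = 0 ∧ W 1 = 0

section Translation

variable {E : Type*} [NormedAddCommGroup E] [NormedSpace ℝ E] [FiniteDimensional ℝ E]
  [MeasurableSpace E] [BorelSpace E] {μ : Measure E} [μ.IsAddHaarMeasure]

open Filter Topology in
/-- The `L¹` modulus of continuity of a compactly supported Lipschitz function is controlled by
the `L¹` norm of its derivative. -/
theorem lintegral_enorm_translate_sub_le {K : NNReal} {f : E → ℝ} (hf : LipschitzWith K f)
    (hc : HasCompactSupport f) (y : E) :
    ∫⁻ x, ‖f (x + y) - f x‖ₑ ∂μ ≤ ‖y‖ₑ * ∫⁻ x, ‖fderiv ℝ f x‖ₑ ∂μ := by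
  have hmeas : ∀ z : E, Measurable fun x => ‖f (x + z) - f x‖ₑ := fun z =>
    (((hf.continuous.comp (continuous_id.add continuous_const)).sub hf.continuous).enorm).measurable
  have hsub : ∀ (N : ℕ) (z : E), ∫⁻ x, ‖f (x + (N : ℝ) • z) - f x‖ₑ ∂μ
      ≤ N * ∫⁻ x, ‖f (x + z) - f x‖ₑ ∂μ := by
    intro N z
    induction N with
    | zero => simp
    | succ N ih =>
      calc ∫⁻ x, ‖f (x + ((N + 1 : ℕ) : ℝ) • z) - f x‖ₑ ∂μ
          ≤ ∫⁻ x, (‖f ((x + z) + (N : ℝ) • z) - f (x + z)‖ₑ + ‖f (x + z) - f x‖ₑ) ∂μ := by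
            refine lintegral_mono fun x => ?_
            refine le_trans (le_of_eq ?_) (enorm_add_le _ _)
            congr 1
            have : x + ((N + 1 : ℕ) : ℝ) • z = x + z + (N : ℝ) • z := by
              push_cast; rw [add_smul, one_smul]; abel
            rw [this]; ring
        _ = ∫⁻ x, ‖f (x + (N : ℝ) • z) - f x‖ₑ ∂μ + ∫⁻ x, ‖f (x + z) - f x‖ₑ ∂μ := by
            rw [lintegral_add_right _ (hmeas z),
              lintegral_add_right_eq_self (fun x => ‖f (x + (N : ℝ) • z) - f x‖ₑ) z]
        _ ≤ _ := by
            refine le_trans (add_le_add_left ih _) (le_of_eq ?_)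
            push_cast; ring
  obtain ⟨C, hC⟩ : ∃ C : Set E, IsCompact C ∧ ∀ t : ℝ, 0 ≤ t → t ≤ 1 → ∀ x, x ∉ C →
      f (x + t • y) - f x = 0 := by
    refine ⟨cthickening ‖y‖ (tsupport f), IsCompact.cthickening hc, fun t ht0 ht1 x hx => ?_⟩
    have A : f x = 0 := by
      rw [← Function.notMem_support]
      contrapose hx
      exact self_subset_cthickening _ (subset_tsupport _ hx)
    have B : f (x + t • y) = 0 := by
      rw [← Function.notMem_support]
      contrapose hx
      apply mem_cthickening_of_dist_le _ _ (‖y‖) (tsupport f) (subset_tsupport _ hx)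
      simp only [dist_eq_norm, sub_add_cancel_left, norm_neg, norm_smul, Real.norm_eq_abs,
        abs_of_nonneg ht0]
      exact mul_le_of_le_one_left (norm_nonneg y) ht1
    rw [A, B, sub_zero]
  have hlim : Tendsto (fun N : ℕ => ∫⁻ x, ((N + 1 : ℕ) : ENNReal) *
      ‖f (x + ((N + 1 : ℕ) : ℝ)⁻¹ • y) - f x‖ₑ ∂μ) atTop
      (𝓝 (∫⁻ x, ‖lineDeriv ℝ f x y‖ₑ ∂μ)) := by
    refine tendsto_lintegral_of_dominated_convergence
      (C.indicator fun _ => (K : ENNReal) * ‖y‖ₑ) (fun N => (hmeas _).const_mul _) ?_ ?_ ?_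
    · intro N
      refine Eventually.of_forall fun x => ?_
      by_cases hx : x ∈ C
      · rw [indicator_of_mem hx]
        calc ((N + 1 : ℕ) : ENNReal) * ‖f (x + ((N + 1 : ℕ) : ℝ)⁻¹ • y) - f x‖ₑ
            ≤ ((N + 1 : ℕ) : ENNReal) * (K * ‖((N + 1 : ℕ) : ℝ)⁻¹ • y‖ₑ) := by
              gcongr
              have := hf (x + ((N + 1 : ℕ) : ℝ)⁻¹ • y) x
              simpa [edist_eq_enorm_sub] using this
          _ = ‖((N + 1 : ℕ) : ℝ)‖ₑ * (K * ‖((N + 1 : ℕ) : ℝ)⁻¹ • y‖ₑ) := by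
              congr 1
              rw [Real.enorm_natCast]
          _ = K * ‖((N + 1 : ℕ) : ℝ) • ((N + 1 : ℕ) : ℝ)⁻¹ • y‖ₑ := by
              rw [enorm_smul ((N + 1 : ℕ) : ℝ)]; ring
          _ = K * ‖y‖ₑ := by
              rw [smul_inv_smul₀ (by positivity)]
      · have h0 := hC.2 ((N + 1 : ℕ) : ℝ)⁻¹ (by positivity)
          (inv_le_one_of_one_le₀ (by push_cast; linarith [N.cast_nonneg (α := ℝ)])) x hx
        simp only [indicator_of_notMem hx, h0, enorm_zero, mul_zero, le_refl]
    · rw [lintegral_indicator_const hC.1.measurableSet]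
      exact ENNReal.mul_ne_top (ENNReal.mul_ne_top (by simp) (by simp)) hC.1.measure_lt_top.ne
    · filter_upwards [hf.ae_lineDifferentiableAt y] with x hx
      have h1 := hx.hasLineDerivAt.tendsto_slope_zero_right
      have h2 : Tendsto (fun N : ℕ => ((N + 1 : ℕ) : ℝ)⁻¹) atTop (𝓝[>] 0) := by
        have := tendsto_inv_atTop_nhdsGT_zero.comp
          (tendsto_natCast_atTop_atTop.comp (tendsto_add_atTop_nat 1) :
            Tendsto (fun N : ℕ => ((N + 1 : ℕ) : ℝ)) atTop atTop)
        exact this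
      refine ((h1.comp h2).enorm).congr fun N => ?_
      simp only [Function.comp_apply, inv_inv, enorm_smul]
      rw [Real.enorm_natCast]
  have hbound : ∀ N : ℕ, ∫⁻ x, ‖f (x + y) - f x‖ₑ ∂μ ≤ ∫⁻ x, ((N + 1 : ℕ) : ENNReal) *
      ‖f (x + ((N + 1 : ℕ) : ℝ)⁻¹ • y) - f x‖ₑ ∂μ := by
    intro N
    rw [lintegral_const_mul _ (hmeas _)]
    have := hsub (N + 1) (((N + 1 : ℕ) : ℝ)⁻¹ • y)
    rwa [smul_inv_smul₀ (by positivity)] at this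
  refine (ge_of_tendsto' hlim hbound).trans ?_
  rw [← lintegral_const_mul _ (measurable_fderiv ℝ f).enorm]
  refine lintegral_mono_ae ?_
  filter_upwards [hf.ae_differentiableAt (μ := μ)] with x hx
  rw [hx.lineDeriv_eq_fderiv, mul_comm]
  exact (fderiv ℝ f x).le_opENorm y

/-- A weak Faber–Krahn inequality: if `f ≥ 0` is supported in a set whose measure is at most half
of that of a ball of radius `r`, then `∫ f ≤ 2 r ∫ ‖∇f‖`. -/
theorem integral_le_two_mul_radius_mul_integral_norm_fderiv {K : NNReal} {f : E → ℝ}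
    (hf : LipschitzWith K f) (hc : HasCompactSupport f) (h0 : ∀ x, 0 ≤ f x) {A : Set E}
    (hA : MeasurableSet A) (hfA : ∀ x ∉ A, f x = 0) {r : ℝ} (hr : 0 < r)
    (hAr : 2 * μ A ≤ μ (ball 0 r)) :
    ∫ x, f x ∂μ ≤ 2 * r * ∫ x, ‖fderiv ℝ f x‖ ∂μ := by
  have hfint : Integrable f μ := hf.continuous.integrable_of_hasCompactSupport hc
  have hdint : Integrable (fderiv ℝ f) μ := by
    have hcd : HasCompactSupport (fderiv ℝ f) := hc.fderiv ℝ
    have hdom : Integrable ((tsupport (fderiv ℝ f)).indicator fun _ => (K : ℝ)) μ :=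
      (integrable_indicator_iff hcd.measurableSet).2
        (integrableOn_const hcd.measure_lt_top.ne)
    refine hdom.mono' (measurable_fderiv ℝ f).aestronglyMeasurable
      (Filter.Eventually.of_forall fun x => ?_)
    by_cases hx : x ∈ tsupport (fderiv ℝ f)
    · rw [indicator_of_mem hx]
      exact norm_fderiv_le_of_lipschitz ℝ hf
    · rw [indicator_of_notMem hx, image_eq_zero_of_notMem_tsupport hx, norm_zero]
  set I : ENNReal := ∫⁻ x, ‖f x‖ₑ ∂μ with hI
  set G : ENNReal := ∫⁻ x, ‖fderiv ℝ f x‖ₑ ∂μ with hG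
  have hIfin : I ≠ ⊤ := hfint.2.ne
  have hGfin : G ≠ ⊤ := hdint.2.ne
  set b : ENNReal := μ (ball 0 r) with hb
  have hb0 : b ≠ 0 := (measure_ball_pos μ 0 hr).ne'
  have hbfin : b ≠ ⊤ := measure_ball_lt_top.ne
  have hmeas : Measurable fun x => ‖f x‖ₑ := hf.continuous.enorm.measurable
  have hmeas2 : Measurable fun z : E × E => ‖f (z.2 + z.1)‖ₑ :=
    (hf.continuous.comp (continuous_snd.add continuous_fst)).enorm.measurable
  have hpt : ∀ y ∈ ball (0 : E) r,
      I ≤ ENNReal.ofReal r * G + ∫⁻ x in A, ‖f (x + y)‖ₑ ∂μ := by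
    intro y hy
    have h1 : I = ∫⁻ x in A, ‖f x‖ₑ ∂μ := by
      rw [hI, ← lintegral_indicator hA]
      refine lintegral_congr fun x => ?_
      by_cases hx : x ∈ A
      · rw [indicator_of_mem hx]
      · rw [indicator_of_notMem hx, hfA x hx, enorm_zero]
    calc I = ∫⁻ x in A, ‖f x‖ₑ ∂μ := h1
      _ ≤ ∫⁻ x in A, (‖f (x + y) - f x‖ₑ + ‖f (x + y)‖ₑ) ∂μ := by
          refine lintegral_mono fun x => ?_
          have := enorm_sub_le (a := f (x + y)) (b := f (x + y) - f x)
          rw [sub_sub_cancel] at this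
          rwa [add_comm] at this
      _ = ∫⁻ x in A, ‖f (x + y) - f x‖ₑ ∂μ + ∫⁻ x in A, ‖f (x + y)‖ₑ ∂μ :=
          lintegral_add_right _ (hmeas.comp (measurable_add_const y))
      _ ≤ _ := by
          gcongr
          refine (setLIntegral_le_lintegral _ _).trans ?_
          refine (lintegral_enorm_translate_sub_le hf hc y).trans ?_
          gcongr
          rw [← ofReal_norm]
          exact ENNReal.ofReal_le_ofReal (by simpa using (mem_ball_zero_iff.1 hy).le)
  have havg : b * I ≤ b * (ENNReal.ofReal r * G) + μ A * I := by
    calc b * I = ∫⁻ _ in ball (0 : E) r, I ∂μ := by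
          rw [setLIntegral_const, mul_comm]
      _ ≤ ∫⁻ y in ball (0 : E) r, (ENNReal.ofReal r * G + ∫⁻ x in A, ‖f (x + y)‖ₑ ∂μ) ∂μ :=
          setLIntegral_mono' measurableSet_ball hpt
      _ = b * (ENNReal.ofReal r * G) + ∫⁻ y in ball (0 : E) r, ∫⁻ x in A, ‖f (x + y)‖ₑ ∂μ ∂μ := by
          rw [lintegral_add_left measurable_const, setLIntegral_const, mul_comm b]
      _ = b * (ENNReal.ofReal r * G) + ∫⁻ x in A, ∫⁻ y in ball (0 : E) r, ‖f (x + y)‖ₑ ∂μ ∂μ := by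
          rw [lintegral_lintegral_swap hmeas2.aemeasurable]
      _ ≤ b * (ENNReal.ofReal r * G) + ∫⁻ _ in A, I ∂μ := by
          gcongr with x
          refine (setLIntegral_le_lintegral _ _).trans (le_of_eq ?_)
          exact lintegral_add_left_eq_self (fun y => ‖f y‖ₑ) x
      _ = _ := by rw [setLIntegral_const, mul_comm (μ A)]
  have hAfin : μ A ≠ ⊤ := by
    intro h
    rw [h] at hAr
    simp at hAr
    exact hbfin hAr
  have e1 : ∫ x, f x ∂μ = I.toReal := by
    rw [integral_eq_lintegral_of_nonneg_ae (Filter.Eventually.of_forall h0)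
      hfint.aestronglyMeasurable]
    congr 1
    refine lintegral_congr fun x => ?_
    rw [Real.enorm_eq_ofReal (h0 x)]
  have e2 : ∫ x, ‖fderiv ℝ f x‖ ∂μ = G.toReal := integral_norm_eq_lintegral_enorm
    hdint.aestronglyMeasurable
  have h2 := ENNReal.toReal_mono (by finiteness) havg
  rw [ENNReal.toReal_add (by finiteness) (by finiteness)] at h2
  simp only [ENNReal.toReal_mul, ENNReal.toReal_ofReal hr.le] at h2
  have h3 := ENNReal.toReal_mono hbfin hAr
  rw [ENNReal.toReal_mul, ENNReal.toReal_ofNat] at h3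
  rw [e1, e2]
  have hbpos : 0 < b.toReal := ENNReal.toReal_pos hb0 hbfin
  have hInn : 0 ≤ I.toReal := ENNReal.toReal_nonneg
  have h4 : b.toReal * I.toReal ≤ b.toReal * (2 * r * G.toReal) := by nlinarith
  exact le_of_mul_le_mul_left h4 hbpos

end Translation

section LocallyLipschitzFunctions

variable {n : ℕ} {Ω : Set (EuclideanSpace ℝ (Fin n))} {v : EuclideanSpace ℝ (Fin n) → ℝ}
  {K : NNReal} {R : ℝ}

theorem LocLipOn.exists_lipschitzOnWith (hv : LocLipOn Ω v)
    (hR : closedBall (0 : EuclideanSpace ℝ (Fin n)) R ⊆ Ω) :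
    ∃ K, LipschitzOnWith K v (closedBall 0 R) := by
  refine LocallyLipschitzOn.exists_lipschitzOnWith_of_compact (isCompact_closedBall _ _) ?_
  intro x hx
  obtain ⟨K, U, hU, hK⟩ := hv x (hR hx)
  exact ⟨K, U, mem_nhdsWithin_of_mem_nhds hU, hK⟩

theorem LipschitzOnWith.ae_differentiableAt_of_mem_ball
    (hv : LipschitzOnWith K v (closedBall (0 : EuclideanSpace ℝ (Fin n)) R)) :
    ∀ᵐ x, x ∈ ball (0 : EuclideanSpace ℝ (Fin n)) R → DifferentiableAt ℝ v x := by
  filter_upwards [hv.ae_differentiableWithinAt_of_mem (μ := volume)] with x hx hxR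
  exact (hx (ball_subset_closedBall hxR)).differentiableAt
    (Filter.mem_of_superset (isOpen_ball.mem_nhds hxR) ball_subset_closedBall)

theorem LipschitzOnWith.norm_fderiv_le_of_mem_ball
    (hv : LipschitzOnWith K v (closedBall (0 : EuclideanSpace ℝ (Fin n)) R))
    {x : EuclideanSpace ℝ (Fin n)} (hx : x ∈ ball 0 R) : ‖fderiv ℝ v x‖ ≤ K :=
  norm_fderiv_le_of_lipschitzOn ℝ
    (Filter.mem_of_superset (isOpen_ball.mem_nhds hx) ball_subset_closedBall) hv

theorem norm_gradient_eq_norm_fderiv (v : EuclideanSpace ℝ (Fin n) → ℝ)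
    (x : EuclideanSpace ℝ (Fin n)) : ‖gradient v x‖ = ‖fderiv ℝ v x‖ := by
  rw [← toDual_gradient, LinearIsometryEquiv.norm_map]

end LocallyLipschitzFunctions

namespace IsAdmissiblePotential

variable {m lam Lam τ : ℝ} {W : ℝ → ℝ}

theorem nonneg (hW : IsAdmissiblePotential m lam Lam W) (hτ : τ ∈ Icc (-1 : ℝ) 1) : 0 ≤ W τ := by
  obtain ⟨-, hpos, -, -, hm1, h1⟩ := hW
  rcases eq_or_lt_of_le hτ.1 with h | h
  · rw [← h, hm1]
  rcases eq_or_lt_of_le hτ.2 with h' | h'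
  · rw [h', h1]
  · exact (hpos τ ⟨h, h'⟩).le

theorem le_mul_rpow (hW : IsAdmissiblePotential m lam Lam W) (hm : 0 < m)
    (hτ : τ ∈ Icc (-1 : ℝ) 1) : W τ ≤ Lam * (1 - τ ^ 2) ^ m := by
  obtain ⟨-, -, hbd, -, hm1, h1⟩ := hW
  rcases eq_or_lt_of_le hτ.1 with h | h
  · rw [← h, hm1]; simp [Real.zero_rpow hm.ne']
  rcases eq_or_lt_of_le hτ.2 with h' | h'
  · rw [h', h1]; simp [Real.zero_rpow hm.ne']
  · have hpos : 0 < 1 - τ ^ 2 := by nlinarith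
    exact (div_le_iff₀ (Real.rpow_pos_of_pos hpos m)).1 (hbd τ ⟨h, h'⟩).2

theorem mul_rpow_le (hW : IsAdmissiblePotential m lam Lam W)
    (hτ : τ ∈ Ioo (-1 : ℝ) 1) : lam * (1 - τ ^ 2) ^ m ≤ W τ := by
  have hpos : 0 < 1 - τ ^ 2 := by nlinarith [hτ.1, hτ.2]
  exact (le_div_iff₀ (Real.rpow_pos_of_pos hpos m)).1 (hW.2.2.1 τ hτ).1

theorem le_const (hW : IsAdmissiblePotential m lam Lam W) (hm : 0 < m) (hL : 0 < Lam)
    (hτ : τ ∈ Icc (-1 : ℝ) 1) : W τ ≤ Lam := by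
  refine (hW.le_mul_rpow hm hτ).trans ?_
  have h0 : 0 ≤ 1 - τ ^ 2 := by nlinarith [hτ.1, hτ.2]
  have := Real.rpow_le_one h0 (by nlinarith [sq_nonneg τ]) hm.le
  nlinarith

theorem exists_measurable (hW : IsAdmissiblePotential m lam Lam W) :
    ∃ W' : ℝ → ℝ, Measurable W' ∧ ∀ τ ∈ Icc (-1 : ℝ) 1, W τ = W' τ := by
  classical
  refine ⟨(Ioo (-1 : ℝ) 1).piecewise W 0,
    ContinuousOn.measurable_piecewise hW.1.continuousOn continuousOn_const measurableSet_Ioo, ?_⟩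
  intro τ hτ
  by_cases h : τ ∈ Ioo (-1 : ℝ) 1
  · rw [piecewise_eq_of_mem _ _ _ h]
  · rw [piecewise_eq_of_notMem _ _ _ h]
    rcases eq_or_lt_of_le hτ.1 with h1 | h1
    · rw [← h1, hW.2.2.2.2.1]; rfl
    · have : τ = 1 := le_antisymm hτ.2 (by by_contra h2; exact h ⟨h1, not_le.1 h2⟩)
      rw [this, hW.2.2.2.2.2]; rfl

theorem integrableOn_energy (hW : IsAdmissiblePotential m lam Lam W) (hm : 0 < m) (hL : 0 < Lam)
    {p : ℝ} (hp : 0 < p) {n : ℕ} {Ω : Set (EuclideanSpace ℝ (Fin n))}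
    {v : EuclideanSpace ℝ (Fin n) → ℝ} (hv : ∀ x, v x ∈ Icc (-1 : ℝ) 1) (hvL : LocLipOn Ω v)
    {R : ℝ} (hR : closedBall (0 : EuclideanSpace ℝ (Fin n)) R ⊆ Ω) :
    IntegrableOn (fun x => ‖gradient v x‖ ^ p + W (v x)) (ball 0 R) := by
  obtain ⟨K, hK⟩ := hvL.exists_lipschitzOnWith hR
  obtain ⟨W', hW'm, hW'⟩ := hW.exists_measurable
  have hmeas : AEStronglyMeasurable (fun x => ‖gradient v x‖ ^ p + W (v x))
      (volume.restrict (ball (0 : EuclideanSpace ℝ (Fin n)) R)) := by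
    have h1 : (fun x => ‖gradient v x‖ ^ p + W (v x))
        = fun x => ‖fderiv ℝ v x‖ ^ p + W' (v x) := by
      funext x
      rw [norm_gradient_eq_norm_fderiv, hW' _ (hv x)]
    rw [h1]
    refine AEMeasurable.aestronglyMeasurable (AEMeasurable.add ?_ ?_)
    · exact ((measurable_fderiv ℝ v).norm.pow_const p).aemeasurable
    · exact hW'm.comp_aemeasurable
        ((hK.continuousOn.mono ball_subset_closedBall).aemeasurable measurableSet_ball)
  have hconst : IntegrableOn (fun _ => (K : ℝ) ^ p + Lam)
      (ball (0 : EuclideanSpace ℝ (Fin n)) R) := integrableOn_const measure_ball_lt_top.ne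
  refine Integrable.mono' hconst hmeas ?_
  filter_upwards [ae_restrict_mem measurableSet_ball] with x hx
  have h1 := hW.nonneg (hv x)
  have h2 := hW.le_const hm hL (hv x)
  rw [norm_gradient_eq_norm_fderiv, Real.norm_of_nonneg (by positivity)]
  gcongr
  exact hK.norm_fderiv_le_of_mem_ball hx

end IsAdmissiblePotential

/-- `w` is an upper barrier for `u`: it lies above `u` outside a ball of radius `r < R`, where the
closed ball of radius `R` is contained in `Ω`. -/
structure IsBarrier {n : ℕ} (Ω : Set (EuclideanSpace ℝ (Fin n)))
    (u w : EuclideanSpace ℝ (Fin n) → ℝ) (r R : ℝ) : Prop where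
  mem_Icc : ∀ x, u x ∈ Icc (-1 : ℝ) 1
  locLipOn : LocLipOn Ω u
  locallyLipschitz : LocallyLipschitz w
  neg_one_le : ∀ x, -1 ≤ w x
  one_le : ∀ x, r ≤ ‖x‖ → 1 ≤ w x
  radius_lt : r < R
  closedBall_subset : closedBall 0 R ⊆ Ω

namespace IsBarrier

variable {n : ℕ} {Ω : Set (EuclideanSpace ℝ (Fin n))} {u w : EuclideanSpace ℝ (Fin n) → ℝ}
  {r R : ℝ}

theorem excess_eq_zero (h : IsBarrier Ω u w r R) {x : EuclideanSpace ℝ (Fin n)} (hx : r ≤ ‖x‖) :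
    max (u x - w x) 0 = 0 :=
  max_eq_right (by linarith [h.one_le x hx, (h.mem_Icc x).2])

theorem hasCompactSupport (h : IsBarrier Ω u w r R) :
    HasCompactSupport fun x => max (u x - w x) 0 :=
  HasCompactSupport.intro (isCompact_closedBall 0 r) fun x hx =>
    h.excess_eq_zero (by simpa using (not_le.1 (fun h' => hx (mem_closedBall_zero_iff.2 h'))).le)

theorem excess_mem_Icc (h : IsBarrier Ω u w r R) (x : EuclideanSpace ℝ (Fin n)) :
    max (u x - w x) 0 ∈ Icc (0 : ℝ) 2 :=
  ⟨le_max_right _ _, max_le (by linarith [h.neg_one_le x, (h.mem_Icc x).2]) (by norm_num)⟩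

theorem exists_lipschitzWith (h : IsBarrier Ω u w r R) :
    ∃ K, LipschitzWith K fun x => max (u x - w x) 0 := by
  set ζ : EuclideanSpace ℝ (Fin n) → ℝ := fun x => max (u x - w x) 0 with hζ
  have hloc : LocLipOn Ω ζ := by
    intro x hx
    obtain ⟨K₁, U₁, hU₁, h₁⟩ := h.locLipOn x hx
    obtain ⟨K₂, U₂, hU₂, h₂⟩ := h.locallyLipschitz x
    have h3 := (h₁.mono (inter_subset_left (t := U₂))).sub (h₂.mono (inter_subset_right (s := U₁)))
    have h4 : LipschitzWith 1 fun t : ℝ => max t 0 := LipschitzWith.id.max_const 0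
    exact ⟨_, _, Filter.inter_mem hU₁ hU₂, h4.comp_lipschitzOnWith h3⟩
  obtain ⟨K, hK⟩ := hloc.exists_lipschitzOnWith h.closedBall_subset
  have hRr : 0 < R - r := sub_pos.2 h.radius_lt
  obtain ⟨M, hM⟩ : ∃ M : NNReal, (M : ℝ) = 2 / (R - r) := ⟨⟨2 / (R - r), by positivity⟩, rfl⟩
  refine ⟨max K M, LipschitzWith.of_dist_le_mul fun x y => ?_⟩
  have key : ∀ x y, R < ‖y‖ → dist (ζ x) (ζ y) ≤ (max K M : NNReal) * dist x y := by
    intro x y hy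
    have hy0 : ζ y = 0 := h.excess_eq_zero (h.radius_lt.le.trans hy.le)
    by_cases hx : r ≤ ‖x‖
    · rw [hy0, show ζ x = 0 from h.excess_eq_zero hx, dist_self]; positivity
    · have h1 : R - r ≤ dist x y := by
        rw [dist_eq_norm, norm_sub_rev]
        linarith [norm_sub_norm_le y x]
      have h2 : dist (ζ x) (ζ y) ≤ 2 := by
        rw [hy0, Real.dist_eq, sub_zero, abs_of_nonneg (h.excess_mem_Icc x).1]
        exact (h.excess_mem_Icc x).2
      calc dist (ζ x) (ζ y) ≤ M * (R - r) := by rw [hM, div_mul_cancel₀ _ hRr.ne']; exact h2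
        _ ≤ _ := by
          gcongr
          exact le_max_right _ _
  by_cases hx : R < ‖x‖
  · rw [dist_comm, dist_comm x]; exact key y x hx
  by_cases hy : R < ‖y‖
  · exact key x y hy
  · refine (hK.dist_le_mul x (by simpa using hx) y (by simpa using hy)).trans ?_
    gcongr
    exact le_max_left _ _

theorem setOf_lt_eq (u w : EuclideanSpace ℝ (Fin n) → ℝ) :
    {x | w x < u x} = {x | 0 < max (u x - w x) 0} := by
  ext x
  simp

theorem isOpen_setOf_lt (h : IsBarrier Ω u w r R) : IsOpen {x | w x < u x} := by
  obtain ⟨K, hK⟩ := h.exists_lipschitzWith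
  rw [setOf_lt_eq]
  exact isOpen_lt continuous_const hK.continuous

theorem setOf_lt_subset_ball (h : IsBarrier Ω u w r R) : {x | w x < u x} ⊆ ball 0 r := by
  intro x (hx : w x < u x)
  rw [mem_ball_zero_iff]
  by_contra hr
  linarith [h.one_le x (not_lt.1 hr), (h.mem_Icc x).2]

theorem setOf_lt_subset_ball' (h : IsBarrier Ω u w r R) : {x | w x < u x} ⊆ ball 0 R :=
  h.setOf_lt_subset_ball.trans (ball_subset_ball h.radius_lt.le)

theorem measure_setOf_lt_ne_top (h : IsBarrier Ω u w r R) : volume {x | w x < u x} ≠ ⊤ :=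
  ((measure_mono h.setOf_lt_subset_ball).trans_lt measure_ball_lt_top).ne

theorem fderiv_excess_of_not_lt {x : EuclideanSpace ℝ (Fin n)} (hx : ¬ w x < u x) :
    fderiv ℝ (fun x => max (u x - w x) 0) x = 0 := by
  refine IsLocalMin.fderiv_eq_zero (Filter.Eventually.of_forall fun y => ?_)
  have : max (u x - w x) 0 = 0 := max_eq_right (by linarith)
  exact this.trans_le (le_max_right _ _)

theorem ae_differentiableAt (h : IsBarrier Ω u w r R) :
    ∀ᵐ x, x ∈ ball 0 R → DifferentiableAt ℝ u x ∧ DifferentiableAt ℝ w x := by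
  obtain ⟨K, hK⟩ := h.locLipOn.exists_lipschitzOnWith h.closedBall_subset
  obtain ⟨K', hK'⟩ := h.locallyLipschitz.locallyLipschitzOn.exists_lipschitzOnWith_of_compact
    (isCompact_closedBall (0 : EuclideanSpace ℝ (Fin n)) R)
  filter_upwards [hK.ae_differentiableAt_of_mem_ball, hK'.ae_differentiableAt_of_mem_ball]
    with x h1 h2 hx using ⟨h1 hx, h2 hx⟩

theorem ae_fderiv_excess (h : IsBarrier Ω u w r R) :
    ∀ᵐ x, w x < u x → fderiv ℝ (fun x => max (u x - w x) 0) x = fderiv ℝ u x - fderiv ℝ w x := by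
  filter_upwards [h.ae_differentiableAt] with x hx hlt
  obtain ⟨h1, h2⟩ := hx (h.setOf_lt_subset_ball' hlt)
  have : (fun x => max (u x - w x) 0) =ᶠ[nhds x] fun x => u x - w x := by
    filter_upwards [h.isOpen_setOf_lt.mem_nhds hlt] with y (hy : w y < u y)
    exact max_eq_left (by linarith)
  rw [this.fderiv_eq, fderiv_fun_sub h1 h2]

/-- Cutting a minimizer off at an upper barrier does not decrease the energy. -/
theorem setIntegral_energy_le (h : IsBarrier Ω u w r R) {p m lam Lam : ℝ} {W : ℝ → ℝ}
    (hp : 0 < p) (hm : 0 < m) (hL : 0 < Lam) (hW : IsAdmissiblePotential m lam Lam W)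
    (hmin : IsMinOfJW p W Ω u) :
    IntegrableOn (fun x => ‖fderiv ℝ u x‖ ^ p + W (u x)) {x | w x < u x} ∧
    IntegrableOn (fun x => ‖fderiv ℝ w x‖ ^ p + W (w x)) {x | w x < u x} ∧
    ∫ x in {x | w x < u x}, (‖fderiv ℝ u x‖ ^ p + W (u x)) ≤
      ∫ x in {x | w x < u x}, (‖fderiv ℝ w x‖ ^ p + W (w x)) := by
  set S : Set (EuclideanSpace ℝ (Fin n)) := {x | w x < u x} with hS
  have hSm : MeasurableSet S := h.isOpen_setOf_lt.measurableSet
  have hSR : S ⊆ ball 0 R := h.setOf_lt_subset_ball'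
  obtain ⟨K, hK⟩ := h.exists_lipschitzWith
  set v : EuclideanSpace ℝ (Fin n) → ℝ := fun x => u x - max (u x - w x) 0 with hv
  have hvmin : ∀ x, v x = min (u x) (w x) := by
    intro x
    rcases le_total (u x) (w x) with hx | hx
    · rw [min_eq_left hx, hv]; simp only; rw [max_eq_right (by linarith), sub_zero]
    · rw [min_eq_right hx, hv]; simp only; rw [max_eq_left (by linarith)]; ring
  have hvI : ∀ x, v x ∈ Icc (-1 : ℝ) 1 := fun x => by
    rw [hvmin]
    exact ⟨le_min (h.mem_Icc x).1 (h.neg_one_le x), (min_le_left _ _).trans (h.mem_Icc x).2⟩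
  have hvL : LocLipOn Ω v := by
    intro x hx
    obtain ⟨K₁, U₁, hU₁, h₁⟩ := h.locLipOn x hx
    exact ⟨_, U₁, hU₁, h₁.sub hK.lipschitzOnWith⟩
  have hu_int := hW.integrableOn_energy hm hL hp h.mem_Icc h.locLipOn h.closedBall_subset
  have hv_int := hW.integrableOn_energy hm hL hp hvI hvL h.closedBall_subset
  have hJ : JW p W u (ball 0 R) ≤ JW p W v (ball 0 R) := by
    refine hmin _ isOpen_ball isBounded_ball
      (closure_ball_subset_closedBall.trans h.closedBall_subset) v hvI hvL ?_
    rintro x ⟨-, hx⟩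
    rw [mem_ball_zero_iff, not_lt] at hx
    simp only [hv]
    rw [h.excess_eq_zero (h.radius_lt.le.trans hx), sub_zero]
  have hon : EqOn (fun x => ‖gradient v x‖ ^ p + W (v x))
      (fun x => ‖fderiv ℝ w x‖ ^ p + W (w x)) S := by
    intro x hx
    have : v =ᶠ[nhds x] w := by
      filter_upwards [h.isOpen_setOf_lt.mem_nhds hx] with y (hy : w y < u y)
      rw [hvmin, min_eq_right hy.le]
    simp only [norm_gradient_eq_norm_fderiv]
    rw [this.fderiv_eq, this.eq_of_nhds]
  have hoff : ∀ᵐ x, x ∈ ball (0 : EuclideanSpace ℝ (Fin n)) R \ S →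
      ‖gradient v x‖ ^ p + W (v x) = ‖gradient u x‖ ^ p + W (u x) := by
    filter_upwards [hK.ae_differentiableAt (μ := volume), h.ae_differentiableAt] with x h1 h2 hx
    have h3 : v x = u x := by rw [hvmin, min_eq_left (not_lt.1 hx.2)]
    have h4 : fderiv ℝ v x = fderiv ℝ u x := by
      rw [hv, fderiv_fun_sub (h2 hx.1).1 h1, fderiv_excess_of_not_lt hx.2, sub_zero]
    rw [h3, norm_gradient_eq_norm_fderiv, norm_gradient_eq_norm_fderiv, h4]
  have hoff' : ∫ x in ball 0 R \ S, (‖gradient v x‖ ^ p + W (v x))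
      = ∫ x in ball 0 R \ S, (‖gradient u x‖ ^ p + W (u x)) :=
    setIntegral_congr_ae (measurableSet_ball.diff hSm) hoff
  have hsplit : ∀ g : EuclideanSpace ℝ (Fin n) → ℝ, IntegrableOn g (ball 0 R) →
      ∫ x in ball 0 R, g x = (∫ x in S, g x) + ∫ x in ball 0 R \ S, g x := by
    intro g hg
    rw [setIntegral_sdiff hSm hg hSR]; ring
  unfold JW at hJ
  rw [hsplit _ hu_int, hsplit _ hv_int, hoff'] at hJ
  rw [setIntegral_congr_fun hSm hon] at hJ
  have hu_eq : (fun x => ‖fderiv ℝ u x‖ ^ p + W (u x))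
      = fun x => ‖gradient u x‖ ^ p + W (u x) := by
    funext x
    rw [norm_gradient_eq_norm_fderiv]
  refine ⟨?_, ?_, ?_⟩
  · rw [hu_eq]; exact hu_int.mono_set hSR
  · exact (hv_int.mono_set hSR).congr_fun hon hSm
  · rw [hu_eq]; linarith

end IsBarrier

section ClearingOut

variable {n : ℕ} {Ω : Set (EuclideanSpace ℝ (Fin n))} {u : EuclideanSpace ℝ (Fin n) → ℝ}

theorem isOpen_ball_inter_superlevel (hu : LocLipOn Ω u) {R : ℝ}
    (hR : closedBall (0 : EuclideanSpace ℝ (Fin n)) R ⊆ Ω) (k : ℝ) :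
    IsOpen (ball 0 R ∩ {x | k < u x}) := by
  obtain ⟨K, hK⟩ := hu.exists_lipschitzOnWith hR
  exact (hK.continuousOn.mono ball_subset_closedBall).isOpen_inter_preimage isOpen_ball isOpen_Ioi

theorem measure_ball_inter_ne_top (R : ℝ) (s : Set (EuclideanSpace ℝ (Fin n))) :
    volume (ball 0 R ∩ s) ≠ ⊤ :=
  ((measure_mono inter_subset_left).trans_lt measure_ball_lt_top).ne

theorem measureReal_ball_zero_eq (n : ℕ) {s : ℝ} (hs : 0 < s) :
    volume.real (ball (0 : EuclideanSpace ℝ (Fin n)) s) =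
      s ^ n * volume.real (ball (0 : EuclideanSpace ℝ (Fin n)) 1) := by
  rw [measureReal_def, Measure.addHaar_ball_of_pos _ _ hs, ENNReal.toReal_mul,
    ENNReal.toReal_ofReal (by positivity), finrank_euclideanSpace_fin, measureReal_def]

theorem lipschitzWith_ramp (k r : ℝ) (L : NNReal) :
    LipschitzWith L fun x : EuclideanSpace ℝ (Fin n) => k + L * max (‖x‖ - r) 0 := by
  refine LipschitzWith.of_dist_le_mul fun x y => ?_
  rw [Real.dist_eq, add_sub_add_left_eq_sub, ← mul_sub, abs_mul, NNReal.abs_eq]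
  gcongr
  refine (abs_max_sub_max_le_abs _ _ _).trans ?_
  rw [sub_sub_sub_cancel_right, dist_eq_norm]
  exact abs_norm_sub_norm_le x y

theorem le_one_add_rpow {t p : ℝ} (ht : 0 ≤ t) (hp : 1 ≤ p) : t ≤ 1 + t ^ p := by
  rcases le_total t 1 with h | h
  · linarith [Real.rpow_nonneg ht p]
  · linarith [Real.self_le_rpow_of_one_le h hp]

/-- One step of a De Giorgi iteration for the superlevel sets of a minimizer. -/
theorem measureReal_superlevel_step {p m lam Lam : ℝ} {W : ℝ → ℝ} (hp : 1 < p) (hm : 0 < m)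
    (hLam : 0 < Lam) (hW : IsAdmissiblePotential m lam Lam W)
    (huI : ∀ x, u x ∈ Icc (-1 : ℝ) 1) (huL : LocLipOn Ω u) (hmin : IsMinOfJW p W Ω u)
    {k k' r R ε : ℝ} (hk : -1 ≤ k) (hrR : r < R)
    (hR : closedBall (0 : EuclideanSpace ℝ (Fin n)) R ⊆ Ω) (hε : 0 < ε)
    (hsmall : 2 * volume (ball (0 : EuclideanSpace ℝ (Fin n)) R ∩ {x | k < u x})
      ≤ volume (ball (0 : EuclideanSpace ℝ (Fin n)) ε)) :
    (k' - k) * volume.real (ball (0 : EuclideanSpace ℝ (Fin n)) r ∩ {x | k' < u x}) ≤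
      2 * ε * (1 + 4 / (R - r) + (4 / (R - r)) ^ p + Lam) *
        volume.real (ball (0 : EuclideanSpace ℝ (Fin n)) R ∩ {x | k < u x}) := by
  have hRr : 0 < R - r := sub_pos.2 hrR
  obtain ⟨L, hL⟩ : ∃ L : NNReal, (L : ℝ) = 4 / (R - r) := ⟨⟨4 / (R - r), by positivity⟩, rfl⟩
  rw [← hL]
  set w : EuclideanSpace ℝ (Fin n) → ℝ := fun x => k + L * max (‖x‖ - r) 0 with hw
  have hwL : LipschitzWith L w := lipschitzWith_ramp k r L
  have hkw : ∀ x, k ≤ w x := fun x => by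
    have : 0 ≤ (L : ℝ) * max (‖x‖ - r) 0 := by positivity
    simp only [hw]; linarith
  have hB : IsBarrier Ω u w ((r + R) / 2) R := by
    refine ⟨huI, huL, hwL.locallyLipschitz, fun x => hk.trans (hkw x), fun x hx => ?_,
      by linarith, hR⟩
    have h1 : (R - r) / 2 ≤ max (‖x‖ - r) 0 := le_max_of_le_left (by linarith)
    have h2 : (L : ℝ) * ((R - r) / 2) ≤ L * max (‖x‖ - r) 0 := by gcongr
    have h3 : (L : ℝ) * ((R - r) / 2) = 2 := by rw [hL]; field_simp; norm_num
    simp only [hw]; linarith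
  obtain ⟨hiu, hiw, hle⟩ := hB.setIntegral_energy_le (by linarith) hm hLam hW hmin
  obtain ⟨K, hK⟩ := hB.exists_lipschitzWith
  set S : Set (EuclideanSpace ℝ (Fin n)) := {x | w x < u x} with hS
  set ζ : EuclideanSpace ℝ (Fin n) → ℝ := fun x => max (u x - w x) 0 with hζ
  set A : Set (EuclideanSpace ℝ (Fin n)) := ball 0 R ∩ {x | k < u x} with hA
  have hSm : MeasurableSet S := hB.isOpen_setOf_lt.measurableSet
  have hSA : S ⊆ A := fun x hx => ⟨hB.setOf_lt_subset_ball' hx, (hkw x).trans_lt hx⟩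
  have hAm : MeasurableSet A := (isOpen_ball_inter_superlevel huL hR k).measurableSet
  have hSfin : volume S ≠ ⊤ := hB.measure_setOf_lt_ne_top
  have hSreal : volume.real S ≤ volume.real A :=
    measureReal_mono hSA (measure_ball_inter_ne_top _ _)
  have hζint : Integrable ζ := hK.continuous.integrable_of_hasCompactSupport hB.hasCompactSupport
  have hfk : ∫ x, ζ x ≤ 2 * ε * ∫ x, ‖fderiv ℝ ζ x‖ := by
    refine integral_le_two_mul_radius_mul_integral_norm_fderiv hK hB.hasCompactSupport
      (fun x => (hB.excess_mem_Icc x).1) hAm (fun x hx => ?_) hε hsmall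
    have : ¬ w x < u x := fun h' => hx (hSA h')
    exact max_eq_right (by linarith)
  have hgrad : ∫ x, ‖fderiv ℝ ζ x‖ ≤ (1 + L + (L : ℝ) ^ p + Lam) * volume.real S := by
    have hWw : ∀ x ∈ S, ‖fderiv ℝ w x‖ ^ p + W (w x) ≤ (L : ℝ) ^ p + Lam := by
      intro x hx
      have h1 : W (w x) ≤ Lam := hW.le_const hm hLam
        ⟨hk.trans (hkw x), le_trans (le_of_lt hx) (huI x).2⟩
      gcongr
      exact norm_fderiv_le_of_lipschitz ℝ hwL
    calc ∫ x, ‖fderiv ℝ ζ x‖ = ∫ x in S, ‖fderiv ℝ ζ x‖ := by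
          refine (setIntegral_eq_integral_of_forall_compl_eq_zero fun x hx => ?_).symm
          rw [hζ, IsBarrier.fderiv_excess_of_not_lt hx, norm_zero]
      _ ≤ ∫ x in S, ((1 + L) + (‖fderiv ℝ u x‖ ^ p + W (u x))) := by
          refine integral_mono_of_nonneg (Filter.Eventually.of_forall fun x => norm_nonneg _)
            ((integrableOn_const hSfin).add hiu) ?_
          filter_upwards [ae_restrict_mem hSm, ae_restrict_of_ae hB.ae_fderiv_excess] with x hx h1
          rw [h1 hx]
          have h2 := norm_sub_le (fderiv ℝ u x) (fderiv ℝ w x)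
          have h3 := norm_fderiv_le_of_lipschitz ℝ hwL (x₀ := x)
          have h4 := le_one_add_rpow (norm_nonneg (fderiv ℝ u x)) hp.le
          have h5 := hW.nonneg (huI x)
          linarith
      _ = (1 + L) * volume.real S + ∫ x in S, (‖fderiv ℝ u x‖ ^ p + W (u x)) := by
          have hc : Integrable (fun _ => 1 + (L : ℝ)) (volume.restrict S) :=
            integrableOn_const hSfin
          rw [integral_add hc hiu, setIntegral_const, smul_eq_mul, mul_comm]
      _ ≤ (1 + L) * volume.real S + ∫ x in S, (‖fderiv ℝ w x‖ ^ p + W (w x)) := by gcongr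
      _ ≤ (1 + L) * volume.real S + ∫ _ in S, ((L : ℝ) ^ p + Lam) := by
          exact add_le_add le_rfl (setIntegral_mono_on hiw (integrableOn_const hSfin) hSm hWw)
      _ = _ := by rw [setIntegral_const, smul_eq_mul]; ring
  have hcheb : (k' - k) * volume.real (ball (0 : EuclideanSpace ℝ (Fin n)) r ∩ {x | k' < u x})
      ≤ ∫ x, ζ x := by
    have hm' : MeasurableSet (ball (0 : EuclideanSpace ℝ (Fin n)) r ∩ {x | k' < u x}) :=
      (isOpen_ball_inter_superlevel huL
        ((closedBall_subset_closedBall hrR.le).trans hR) k').measurableSet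
    calc _ = ∫ _ in ball (0 : EuclideanSpace ℝ (Fin n)) r ∩ {x | k' < u x}, (k' - k) := by
          rw [setIntegral_const, smul_eq_mul, mul_comm]
      _ ≤ ∫ x in ball (0 : EuclideanSpace ℝ (Fin n)) r ∩ {x | k' < u x}, ζ x := by
          refine setIntegral_mono_on (integrableOn_const (measure_ball_inter_ne_top _ _))
            hζint.integrableOn hm' fun x hx => le_max_of_le_left ?_
          have h1 : max (‖x‖ - r) 0 = 0 := max_eq_right (by
            linarith [mem_ball_zero_iff.1 hx.1])
          have h2 : k' < u x := hx.2
          simp only [hw, h1, mul_zero, add_zero]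
          linarith
      _ ≤ ∫ x, ζ x := setIntegral_le_integral hζint
          (Filter.Eventually.of_forall fun x => (hB.excess_mem_Icc x).1)
  calc _ ≤ ∫ x, ζ x := hcheb
    _ ≤ 2 * ε * ∫ x, ‖fderiv ℝ ζ x‖ := hfk
    _ ≤ 2 * ε * ((1 + L + (L : ℝ) ^ p + Lam) * volume.real A) := by 
      gcongr; exact hgrad.trans (by gcongr)
    _ = _ := by ring

/-- If a minimizer vanishes at the origin, then its superlevel set `{u > -1/2}` occupies a
universal amount of the unit ball. -/
theorem exists_pos_le_measureReal_superlevel (n : ℕ) {p m lam Lam : ℝ} (hn : n ≠ 0) (hp : 1 < p)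
    (hm : 0 < m) (hLam : 0 < Lam) :
    ∃ c > (0 : ℝ), ∀ W : ℝ → ℝ, IsAdmissiblePotential m lam Lam W →
      ∀ (Ω : Set (EuclideanSpace ℝ (Fin n))) (u : EuclideanSpace ℝ (Fin n) → ℝ),
        (∀ x, u x ∈ Icc (-1 : ℝ) 1) → LocLipOn Ω u → IsMinOfJW p W Ω u → u 0 = 0 →
        closedBall (0 : EuclideanSpace ℝ (Fin n)) 1 ⊆ Ω →
        c ≤ volume.real (ball (0 : EuclideanSpace ℝ (Fin n)) 1 ∩ {x | -1 / 2 < u x}) := by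
  set ω : ℝ := volume.real (ball (0 : EuclideanSpace ℝ (Fin n)) 1) with hω
  have hωpos : 0 < ω := 
    ENNReal.toReal_pos (measure_ball_pos _ _ one_pos).ne' measure_ball_lt_top.ne
  set B : ℝ := 2 * 2 ^ p with hB
  set C : ℝ := 16 * (1 + 16 + 16 ^ p + Lam) with hC
  have hBpos : 0 < B := by positivity
  have hCpos : 0 < C := by positivity
  have hB1 : 1 ≤ B := by
    have : (1 : ℝ) ≤ 2 ^ p := Real.one_le_rpow (by norm_num) (by linarith)
    rw [hB]; linarith
  set ε : ℝ := (B⁻¹) ^ n / C with hε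
  have hεpos : 0 < ε := by positivity
  refine ⟨ω / 2 * ε ^ n, by positivity, fun W hW Ω u huI huL hmin hu0 hΩ => ?_⟩
  by_contra! hlt
  set rad : ℕ → ℝ := fun j => 1 / 2 + (1 / 2) ^ j / 2 with hrad
  set lev : ℕ → ℝ := fun j => -1 / 4 - (1 / 2) ^ j / 4 with hlev
  set a : ℕ → ℝ := fun j =>
    volume.real (ball (0 : EuclideanSpace ℝ (Fin n)) (rad j) ∩ {x | lev j < u x}) with ha
  have hpow : ∀ j : ℕ, (0 : ℝ) < (1 / 2) ^ j ∧ ((1 : ℝ) / 2) ^ j ≤ 1 := fun j =>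
    ⟨by positivity, pow_le_one₀ (by norm_num) (by norm_num)⟩
  have hstep : ∀ j, a j ≤ ω / 2 * (ε * (B⁻¹) ^ j) ^ n := by
    intro j
    induction j with
    | zero =>
      have h1 : rad 0 = 1 := by simp only [hrad]; norm_num
      have h2 : lev 0 = -1 / 2 := by simp only [hlev]; norm_num
      simp only [ha, h1, h2, pow_zero, mul_one]
      exact hlt.le
    | succ j ih =>
      have hs : 0 < ε * (B⁻¹) ^ j := by positivity
      obtain ⟨hj0, hj1⟩ := hpow j
      have hsub : rad j - rad (j + 1) = (1 / 2) ^ j / 4 := by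
        simp only [hrad, pow_succ]; ring
      have hL : 4 / (rad j - rad (j + 1)) = 16 * 2 ^ j := by
        rw [hsub, one_div, inv_pow]; field_simp; norm_num
      have key := measureReal_superlevel_step hp hm hLam hW huI huL hmin (k := lev j)
        (k' := lev (j + 1)) (r := rad (j + 1)) (R := rad j) (ε := ε * (B⁻¹) ^ j)
        (by simp only [hlev]; linarith)
        (by linarith)
        ((closedBall_subset_closedBall (by simp only [hrad]; linarith)).trans hΩ) hs
        (by
          rw [← ENNReal.toReal_le_toReal
            (ENNReal.mul_ne_top (by simp) (measure_ball_inter_ne_top _ _)) measure_ball_lt_top.ne,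
            ENNReal.toReal_mul, ENNReal.toReal_ofNat]
          have h1 := measureReal_ball_zero_eq n hs
          rw [measureReal_def, ← hω] at h1
          rw [h1]
          have h2 : a j = (volume (ball (0 : EuclideanSpace ℝ (Fin n)) (rad j) ∩
            {x | lev j < u x})).toReal := rfl
          rw [← h2]
          linarith)
      rw [hL] at key
      have hlevsub : lev (j + 1) - lev j = (1 / 2) ^ j / 8 := by
        simp only [hlev, pow_succ]; ring
      rw [hlevsub] at key
      have hpp : (16 * 2 ^ j : ℝ) ^ p = 16 ^ p * (2 ^ p) ^ j := by
        rw [Real.mul_rpow (by norm_num) (by positivity), ← Real.rpow_natCast 2 j,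
          ← Real.rpow_mul (by norm_num), mul_comm (j : ℝ) p, Real.rpow_mul (by norm_num),
          Real.rpow_natCast]
      have h2p : (2 : ℝ) ≤ 2 ^ p := by
        simpa using Real.self_le_rpow_of_one_le (x := 2) (by norm_num) hp.le
      have h2j : (2 : ℝ) ^ j ≤ (2 ^ p) ^ j := pow_le_pow_left₀ (by norm_num) h2p j
      have h1j : (1 : ℝ) ≤ (2 ^ p) ^ j := one_le_pow₀ (by linarith)
      have hconst : 1 + 16 * 2 ^ j + (16 * 2 ^ j : ℝ) ^ p + Lam
          ≤ (1 + 16 + 16 ^ p + Lam) * (2 ^ p) ^ j := by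
        rw [hpp]; nlinarith
      have haj : 0 ≤ a j := measureReal_nonneg
      have hmain : a (j + 1) ≤ (B⁻¹) ^ n * a j := by
        have e1 : (1 / 2 : ℝ) ^ j / 8 * a (j + 1) ≤ 2 * (ε * (B⁻¹) ^ j) *
            ((1 + 16 + 16 ^ p + Lam) * (2 ^ p) ^ j) * a j := by
          refine key.trans ?_
          gcongr
        have e2 : 2 * (ε * (B⁻¹) ^ j) * ((1 + 16 + 16 ^ p + Lam) * (2 ^ p) ^ j) * a j
            = (1 / 2 : ℝ) ^ j / 8 * ((B⁻¹) ^ n * a j) := by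
          have e3 : (B⁻¹) ^ j * (2 ^ p) ^ j = (1 / 2 : ℝ) ^ j := by
            rw [← mul_pow, hB]; congr 1; field_simp
          have e4 : ε * C = (B⁻¹) ^ n := by rw [hε]; field_simp
          rw [← e4, ← e3, hC]; ring
        rw [e2] at e1
        exact le_of_mul_le_mul_left e1 (by positivity)
      calc a (j + 1) ≤ (B⁻¹) ^ n * a j := hmain
        _ ≤ (B⁻¹) ^ n * (ω / 2 * (ε * (B⁻¹) ^ j) ^ n) := by gcongr
        _ = _ := by rw [pow_succ]; ring
  have hΩ' : closedBall (0 : EuclideanSpace ℝ (Fin n)) (1 / 2) ⊆ Ω :=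
    (closedBall_subset_closedBall (by norm_num)).trans hΩ
  have hlim0 : 0 < volume.real (ball (0 : EuclideanSpace ℝ (Fin n)) (1 / 2) ∩
      {x | -1 / 4 < u x}) := by
    refine ENNReal.toReal_pos (IsOpen.measure_pos volume
      (isOpen_ball_inter_superlevel huL hΩ' _) ⟨0, ?_⟩).ne' (measure_ball_inter_ne_top _ _)
    refine ⟨mem_ball_self (by norm_num), ?_⟩
    show -1 / 4 < u 0
    rw [hu0]; norm_num
  have hle : ∀ j, volume.real (ball (0 : EuclideanSpace ℝ (Fin n)) (1 / 2) ∩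
      {x | -1 / 4 < u x}) ≤ ω / 2 * (ε * (B⁻¹) ^ j) ^ n := by
    intro j
    refine le_trans (measureReal_mono ?_ (measure_ball_inter_ne_top _ _)) (hstep j)
    have := (hpow j).1
    refine inter_subset_inter (ball_subset_ball (by simp only [hrad]; linarith)) fun x hx => ?_
    have hx' : -1 / 4 < u x := hx
    show lev j < u x
    simp only [hlev]; linarith
  have hB2 : B⁻¹ < 1 := inv_lt_one_of_one_lt₀ (by
    have : (1 : ℝ) < 2 ^ p := Real.one_lt_rpow (by norm_num) (by linarith)
    rw [hB]; linarith)
  have ht : Filter.Tendsto (fun j : ℕ => ω / 2 * (ε * (B⁻¹) ^ j) ^ n) Filter.atTop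
      (nhds (ω / 2 * (ε * 0) ^ n)) :=
    (((tendsto_pow_atTop_nhds_zero_of_lt_one (by positivity) hB2).const_mul ε).pow n).const_mul _
  rw [mul_zero, zero_pow hn, mul_zero] at ht
  exact absurd (ge_of_tendsto' ht hle) (not_le.2 hlim0)

end ClearingOut

section Calibration

/-- Convexity of `‖·‖ ^ p`, with the subgradient at `b` represented by a dual vector `X`. -/
theorem rpow_norm_sub_ge {E : Type*} [NormedAddCommGroup E] [NormedSpace ℝ E] {p q : ℝ}
    (hpq : p.HolderConjugate q) {a b : E →L[ℝ] ℝ} {X : E} (hb : b X = ‖b‖ ^ p)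
    (hX : ‖X‖ ^ q = ‖b‖ ^ p) : p * (a - b) X ≤ ‖a‖ ^ p - ‖b‖ ^ p := by
  have h1 : a X ≤ ‖a‖ * ‖X‖ := (le_abs_self _).trans (a.le_opNorm X)
  have h2 := Real.young_inequality_of_nonneg (norm_nonneg a) (norm_nonneg X) hpq
  rw [hX] at h2
  have h3 : p * (‖a‖ ^ p / p + ‖b‖ ^ p / q) = ‖a‖ ^ p + (p - 1) * ‖b‖ ^ p := by
    have := hpq.pos.ne'
    have := hpq.symm.pos.ne'
    have h4 := hpq.mul_eq_add
    field_simp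
    linear_combination (-‖b‖ ^ p) * h4
  have h4 : p * a X ≤ p * (‖a‖ ^ p / p + ‖b‖ ^ p / q) :=
    mul_le_mul_of_nonneg_left (h1.trans h2) hpq.nonneg
  rw [sub_apply, hb]
  linarith

variable {n : ℕ}

/-- Weak divergence bound for a Lipschitz vector field. -/
theorem abs_integral_fderiv_apply_le {K D : NNReal} {ζ : EuclideanSpace ℝ (Fin n) → ℝ}
    {X : EuclideanSpace ℝ (Fin n) → EuclideanSpace ℝ (Fin n)} (hζ : LipschitzWith K ζ)
    (hc : HasCompactSupport ζ) (h0 : ∀ x, 0 ≤ ζ x) (hX : LipschitzWith D X) :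
    Integrable (fun x => fderiv ℝ ζ x (X x)) ∧
      |∫ x, fderiv ℝ ζ x (X x)| ≤ n * D * ∫ x, ζ x := by
  have hζint : Integrable ζ := hζ.continuous.integrable_of_hasCompactSupport hc
  set e : Fin n → EuclideanSpace ℝ (Fin n) := fun i => EuclideanSpace.single i 1 with he
  have he1 : ∀ i, ‖e i‖ = 1 := fun i => by simp [he]
  have hXi : ∀ i, LipschitzWith D fun x => X x i := fun i => by
    refine LipschitzWith.of_dist_le_mul fun x y => ?_
    refine le_trans ?_ (hX.dist_le_mul x y)
    rw [dist_eq_norm, dist_eq_norm]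
    exact PiLp.norm_apply_le (X x - X y) i
  have hcoord : ∀ i, Integrable fun x => lineDeriv ℝ ζ x (e i) * X x i := by
    intro i
    have hsupp : Function.support (fun x => lineDeriv ℝ ζ x (e i) * X x i) ⊆ tsupport ζ := by
      intro x hx
      by_contra hx'
      refine hx ?_
      have : ζ =ᶠ[nhds x] 0 := notMem_tsupport_iff_eventuallyEq.1 hx'
      simp only
      rw [this.lineDeriv_eq]
      simp [lineDeriv]
    rw [← integrableOn_iff_integrable_of_support_subset hsupp]
    exact ((hζ.locallyIntegrable_lineDeriv (e i)).integrableOn_isCompact hc).mul_continuousOn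
      (hXi i).continuous.continuousOn hc
  have hae : (fun x => fderiv ℝ ζ x (X x)) =ᵐ[volume]
      fun x => ∑ i, lineDeriv ℝ ζ x (e i) * X x i := by
    filter_upwards [hζ.ae_differentiableAt (μ := volume)] with x hx
    have h1 : X x = ∑ i, X x i • e i := by
      have := (EuclideanSpace.basisFun (Fin n) ℝ).sum_repr (X x)
      simpa [he] using this.symm
    conv_lhs => rw [h1]
    rw [map_sum]
    refine Finset.sum_congr rfl fun i _ => ?_
    rw [map_smul, smul_eq_mul, hx.lineDeriv_eq_fderiv, mul_comm]
  have hterm : ∀ i, |∫ x, lineDeriv ℝ ζ x (e i) * X x i| ≤ D * ∫ x, ζ x := by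
    intro i
    have h1 := (hXi i).integral_lineDeriv_mul_eq (μ := volume) hζ hc (-e i)
    rw [neg_neg] at h1
    rw [← h1, ← Real.norm_eq_abs, ← integral_const_mul]
    refine norm_integral_le_of_norm_le (hζint.const_mul _)
      (Filter.Eventually.of_forall fun x => ?_)
    rw [norm_mul, Real.norm_of_nonneg (h0 x)]
    refine mul_le_mul_of_nonneg_right ?_ (h0 x)
    refine (norm_lineDeriv_le_of_lipschitz ℝ (hXi i)).trans_eq ?_
    rw [norm_neg, he1, mul_one]
  refine ⟨(integrable_finsetSum _ fun i _ => hcoord i).congr hae.symm, ?_⟩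
  rw [integral_congr_ae hae, integral_finsetSum _ fun i _ => hcoord i]
  refine (Finset.abs_sum_le_sum_abs _ _).trans ((Finset.sum_le_sum fun i _ => hterm i).trans_eq ?_)
  simp [mul_assoc]

/-- The displacement from a point to its radial projection onto `closedBall 0 r`. -/
def radialExcess (r : ℝ) (x : EuclideanSpace ℝ (Fin n)) : EuclideanSpace ℝ (Fin n) :=
  x - (r / max ‖x‖ r) • x

theorem lipschitzWith_radialExcess {r : ℝ} (hr : 0 < r) :
    LipschitzWith 3 (radialExcess r : EuclideanSpace ℝ (Fin n) → EuclideanSpace ℝ (Fin n)) := by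
  refine LipschitzWith.of_dist_le_mul fun x y => ?_
  rw [dist_eq_norm, dist_eq_norm]
  set M := max ‖x‖ r with hM
  set N := max ‖y‖ r with hN
  have hMr : r ≤ M := le_max_right _ _
  have hNr : r ≤ N := le_max_right _ _
  have hMp : 0 < M := hr.trans_le hMr
  have hNp : 0 < N := hr.trans_le hNr
  have hyN : ‖y‖ ≤ N := le_max_left _ _
  have e : radialExcess r x - radialExcess r y
      = (x - y) - ((r / M) • (x - y) + (r / M - r / N) • y) := by
    simp only [radialExcess, ← hM, ← hN, smul_sub, sub_smul]
    abel
  have h1 : r / M ≤ 1 := (div_le_one hMp).2 hMr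
  have h2 : |r / M - r / N| * ‖y‖ ≤ ‖x - y‖ := by
    have h3 : |N - M| ≤ ‖x - y‖ := by
      refine (abs_max_sub_max_le_abs _ _ _).trans ?_
      rw [norm_sub_rev]
      exact abs_norm_sub_norm_le y x
    have h4 : r / M - r / N = (r / M) * ((N - M) / N) := by field_simp
    rw [h4, abs_mul, abs_of_pos (div_pos hr hMp), abs_div, abs_of_pos hNp]
    calc r / M * (|N - M| / N) * ‖y‖ ≤ 1 * (|N - M| / N) * N := by gcongr
      _ = |N - M| := by field_simp
      _ ≤ _ := h3
  rw [e]
  calc _ ≤ ‖x - y‖ + (‖(r / M) • (x - y)‖ + ‖(r / M - r / N) • y‖) :=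
        (norm_sub_le _ _).trans (by gcongr; exact norm_add_le _ _)
    _ ≤ ‖x - y‖ + (1 * ‖x - y‖ + ‖x - y‖) := by
        rw [norm_smul, norm_smul, Real.norm_eq_abs, Real.norm_eq_abs,
          abs_of_pos (div_pos hr hMp)]
        gcongr
    _ = _ := by push_cast; ring

theorem radialExcess_of_norm_le {r : ℝ} (hr : 0 < r) {x : EuclideanSpace ℝ (Fin n)}
    (hx : ‖x‖ ≤ r) : radialExcess r x = 0 := by
  rw [radialExcess, max_eq_right hx, div_self hr.ne', one_smul, sub_self]

theorem radialExcess_of_lt_norm {r : ℝ} (hr : 0 < r) {x : EuclideanSpace ℝ (Fin n)}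
    (hx : r < ‖x‖) : radialExcess r x = ((‖x‖ - r) / ‖x‖) • x := by
  have : ‖x‖ ≠ 0 := (hr.trans hx).ne'
  rw [radialExcess, max_eq_left hx.le, sub_div, div_self this, sub_smul, one_smul]

/-- The profile equal to `b` on `closedBall 0 r` and growing like `dist ^ q` outside. -/
def powerBarrier (b κ q r : ℝ) (x : EuclideanSpace ℝ (Fin n)) : ℝ :=
  b + κ * max (‖x‖ - r) 0 ^ q

theorem powerBarrier_of_norm_le {b κ q r : ℝ} (hq : q ≠ 0) {x : EuclideanSpace ℝ (Fin n)}
    (hx : ‖x‖ ≤ r) : powerBarrier b κ q r x = b := by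
  rw [powerBarrier, max_eq_right (by linarith), Real.zero_rpow hq, mul_zero, add_zero]

theorem le_powerBarrier {b κ q r : ℝ} (hκ : 0 ≤ κ) (x : EuclideanSpace ℝ (Fin n)) :
    b ≤ powerBarrier b κ q r x := by
  have : 0 ≤ κ * max (‖x‖ - r) 0 ^ q := by positivity
  rw [powerBarrier]; linarith

theorem locallyLipschitz_powerBarrier (b κ r : ℝ) {q : ℝ} (hq : 1 ≤ q) :
    LocallyLipschitz (powerBarrier b κ q r : EuclideanSpace ℝ (Fin n) → ℝ) := by
  have h1 : LocallyLipschitz fun t : ℝ => b + κ * t ^ q :=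
    (contDiff_const.add (contDiff_const.mul
      (Real.contDiff_rpow_const_of_le (n := 1) (by simpa using hq)))).locallyLipschitz
  have h2 : LocallyLipschitz fun x : EuclideanSpace ℝ (Fin n) => max (‖x‖ - r) 0 := by
    have := lipschitzWith_ramp (n := n) 0 r 1
    simp only [zero_add, NNReal.coe_one, one_mul] at this
    exact this.locallyLipschitz
  exact h1.comp h2

theorem fderiv_powerBarrier_radialExcess {p q b κ r : ℝ} (hpq : p.HolderConjugate q) (hκ : 0 < κ)
    (hr : 0 < r) {x : EuclideanSpace ℝ (Fin n)} (hx : ‖x‖ ≠ r) :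
    fderiv ℝ (powerBarrier b κ q r) x ((κ * q) ^ (p - 1) • radialExcess r x)
        = ‖fderiv ℝ (powerBarrier b κ q r) x‖ ^ p ∧
      ‖(κ * q) ^ (p - 1) • radialExcess r x‖ ^ q
        = ‖fderiv ℝ (powerBarrier b κ q r) x‖ ^ p := by
  have hp : p ≠ 0 := hpq.ne_zero
  have hq : q ≠ 0 := hpq.symm.ne_zero
  rcases hx.lt_or_gt with hx | hx
  · have h1 : powerBarrier b κ q r =ᶠ[nhds x] fun _ => b := by
      filter_upwards [continuous_norm.continuousAt.eventually_lt_const hx] with y hy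
      exact powerBarrier_of_norm_le hq hy.le
    rw [h1.fderiv_eq, radialExcess_of_norm_le hr hx.le]
    simp [Real.zero_rpow hp, Real.zero_rpow hq]
  · have hx0 : 0 < ‖x‖ := hr.trans hx
    have ht : 0 < ‖x‖ - r := sub_pos.2 hx
    have hs : 0 < κ * q := mul_pos hκ hpq.symm.pos
    set t := ‖x‖ - r with htdef
    have hnorm : HasFDerivAt (fun y : EuclideanSpace ℝ (Fin n) => ‖y‖) (‖x‖⁻¹ • innerSL ℝ x) x := by
      have h2 := (hasStrictFDerivAt_norm_sq x).hasFDerivAt.sqrt (by positivity)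
      simp only [Real.sqrt_sq (norm_nonneg _)] at h2
      have h3 : (1 / (2 * ‖x‖)) • 2 • innerSL ℝ x = ‖x‖⁻¹ • innerSL ℝ x := by
        rw [← Nat.cast_smul_eq_nsmul ℝ, smul_smul]
        congr 1
        field_simp
        norm_num
      rwa [h3] at h2
    have h1 : powerBarrier b κ q r =ᶠ[nhds x] fun y => b + κ * (‖y‖ - r) ^ q := by
      filter_upwards [continuous_norm.continuousAt.eventually_const_lt hx] with y hy
      rw [powerBarrier, max_eq_left (by linarith)]
    have hfd : fderiv ℝ (powerBarrier b κ q r) x = (κ * q * t ^ (q - 1)) • ‖x‖⁻¹ • innerSL ℝ x := by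
      rw [h1.fderiv_eq]
      have h3 := (((hnorm.sub_const r).rpow_const (p := q) (Or.inl ht.ne')).const_mul κ).const_add b
      rw [h3.fderiv, smul_smul, mul_assoc]
    have hfn : ‖fderiv ℝ (powerBarrier b κ q r) x‖ = κ * q * t ^ (q - 1) := by
      rw [hfd, norm_smul, norm_smul, innerSL_apply_norm, norm_inv, norm_norm,
        inv_mul_cancel₀ hx0.ne', mul_one, Real.norm_of_nonneg (by positivity)]
    have hpow : (κ * q * t ^ (q - 1)) ^ p = (κ * q) ^ p * t ^ q := by
      rw [Real.mul_rpow hs.le (by positivity), ← Real.rpow_mul ht.le]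
      congr 2
      linear_combination hpq.mul_eq_add
    rw [hfn, hpow, radialExcess_of_lt_norm hr hx, ← htdef]
    constructor
    · rw [hfd]
      simp only [map_smul, smul_apply, innerSL_apply_apply, real_inner_self_eq_norm_sq,
        smul_eq_mul]
      have e1 : (κ * q) ^ p = (κ * q) ^ (p - 1) * (κ * q) := by
        rw [← Real.rpow_add_one hs.ne']; congr 1; ring
      have e2 : t ^ q = t ^ (q - 1) * t := by
        rw [← Real.rpow_add_one ht.ne']; congr 1; ring
      rw [e1, e2]
      field_simp
    · rw [norm_smul, norm_smul, Real.norm_of_nonneg (by positivity),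
        Real.norm_of_nonneg (by positivity), div_mul_cancel₀ _ hx0.ne',
        Real.mul_rpow (by positivity) ht.le, ← Real.rpow_mul hs.le]
      congr 2
      linear_combination hpq.mul_eq_add

end Calibration
section DensityGrowth

variable {n : ℕ} {Ω : Set (EuclideanSpace ℝ (Fin n))} {u w : EuclideanSpace ℝ (Fin n) → ℝ}

/-- Testing minimality against a calibrated barrier `w` makes the gradient terms disappear. -/
theorem IsBarrier.setIntegral_nonneg {r R : ℝ} (h : IsBarrier Ω u w r R) {p q m lam Lam : ℝ}
    {W : ℝ → ℝ} (hpq : p.HolderConjugate q) (hm : 0 < m) (hL : 0 < Lam)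
    (hW : IsAdmissiblePotential m lam Lam W) (hmin : IsMinOfJW p W Ω u)
    {X : EuclideanSpace ℝ (Fin n) → EuclideanSpace ℝ (Fin n)} {D : NNReal} (hX : LipschitzWith D X)
    (hcal : ∀ᵐ x, fderiv ℝ w x (X x) = ‖fderiv ℝ w x‖ ^ p ∧ ‖X x‖ ^ q = ‖fderiv ℝ w x‖ ^ p)
    {G : EuclideanSpace ℝ (Fin n) → ℝ} (hG : IntegrableOn G {x | w x < u x})
    (hle : ∀ x, w x < u x → W (w x) - W (u x) + p * (n * D) * (u x - w x) ≤ G x) :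
    0 ≤ ∫ x in {x | w x < u x}, G x := by
  obtain ⟨hiu, hiw, henergy⟩ := h.setIntegral_energy_le hpq.pos hm hL hW hmin
  obtain ⟨K, hK⟩ := h.exists_lipschitzWith
  set S : Set (EuclideanSpace ℝ (Fin n)) := {x | w x < u x} with hS
  set ζ : EuclideanSpace ℝ (Fin n) → ℝ := fun x => max (u x - w x) 0 with hζ
  have hSm : MeasurableSet S := h.isOpen_setOf_lt.measurableSet
  obtain ⟨hXint, hXle⟩ := abs_integral_fderiv_apply_le hK h.hasCompactSupport
    (fun x => (h.excess_mem_Icc x).1) hX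
  have hζint : Integrable ζ := hK.continuous.integrable_of_hasCompactSupport h.hasCompactSupport
  have h1 : ∫ x in S, ζ x = ∫ x, ζ x :=
    setIntegral_eq_integral_of_forall_compl_eq_zero fun x hx => max_eq_right (by
      have : ¬ w x < u x := hx
      linarith)
  have h2 : ∫ x in S, fderiv ℝ ζ x (X x) = ∫ x, fderiv ℝ ζ x (X x) :=
    setIntegral_eq_integral_of_forall_compl_eq_zero fun x hx => by
      rw [hζ, IsBarrier.fderiv_excess_of_not_lt hx, zero_apply]
  have hi1 : Integrable (fun x => (‖fderiv ℝ w x‖ ^ p + W (w x)) - (‖fderiv ℝ u x‖ ^ p + W (u x)))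
    (volume.restrict S) := hiw.sub hiu
  have hi2 := (hXint.integrableOn (s := S)).const_mul p
  have hi3 := (hζint.integrableOn (s := S)).const_mul (p * (n * D))
  have hi12 : Integrable (fun x => (‖fderiv ℝ w x‖ ^ p + W (w x)) - (‖fderiv ℝ u x‖ ^ p + W (u x))
      + p * fderiv ℝ ζ x (X x)) (volume.restrict S) := hi1.add hi2
  have key : ∫ x in S, (((‖fderiv ℝ w x‖ ^ p + W (w x)) - (‖fderiv ℝ u x‖ ^ p + W (u x))
      + p * fderiv ℝ ζ x (X x)) + p * (n * D) * ζ x) ≤ ∫ x in S, G x := by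
    refine integral_mono_ae (hi12.add hi3) hG ?_
    filter_upwards [ae_restrict_mem hSm, ae_restrict_of_ae h.ae_fderiv_excess,
      ae_restrict_of_ae hcal] with x hx hf hc
    have hx' : w x < u x := hx
    have h3 := rpow_norm_sub_ge hpq (a := fderiv ℝ u x) hc.1 hc.2
    have h4 := hle x hx
    have h5 : ζ x = u x - w x := max_eq_left (by linarith)
    rw [← hf hx] at h3
    rw [h5]
    linarith
  rw [integral_add hi12 hi3, integral_add hi1 hi2, integral_sub hiw hiu,
    integral_const_mul, integral_const_mul, h1, h2] at key
  have h3 := mul_le_mul_of_nonneg_left (abs_le.1 hXle).1 hpq.nonneg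
  linarith

theorem IsAdmissiblePotential.mul_sub_le_sub {m lam Lam c s t : ℝ} {W : ℝ → ℝ}
    (hW : IsAdmissiblePotential m lam Lam W) (hm : 1 ≤ m) (hlam : 0 ≤ lam) (hc : 0 < c)
    (hs : -1 + c ≤ s) (hst : s ≤ t) (ht : t ≤ -1 / 2) :
    lam * c ^ (m - 1) * (t - s) ≤ W t - W s := by
  have hd : DifferentiableOn ℝ W (Ioo (-1) 1) := hW.1.differentiableOn one_ne_zero
  have hsub : Icc s t ⊆ Ioo (-1) 1 := fun τ hτ => ⟨by linarith [hτ.1], by linarith [hτ.2]⟩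
  refine (convex_Icc s t).mul_sub_le_image_sub_of_le_deriv (hd.continuousOn.mono hsub)
    (hd.mono (interior_subset.trans hsub)) (fun τ hτ => ?_) s (left_mem_Icc.2 hst) t
    (right_mem_Icc.2 hst) hst
  rw [interior_Icc] at hτ
  have h1 : -1 + c < τ := hs.trans_lt hτ.1
  have h2 : τ < -1 / 2 := hτ.2.trans_le ht
  have habs : |τ| = -τ := abs_of_neg (by linarith)
  have h3 : c ≤ 1 - τ ^ 2 := by nlinarith
  have h4 := (hW.2.2.2.1 τ (by rw [habs]; linarith) (by rw [habs]; linarith)).1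
  rw [Real.sign_of_neg (by linarith), mul_neg_one, neg_neg,
    le_div_iff₀ (Real.rpow_pos_of_pos (hc.trans_le h3) _)] at h4
  refine le_trans ?_ h4
  gcongr

theorem setIntegral_indicator_const_le {α : Type*} [MeasurableSpace α] {ν : Measure α}
    {s t : Set α} {M : ℝ} (hM : 0 ≤ M) (ht : MeasurableSet t) (hfin : ν t ≠ ⊤) :
    ∫ x in s, t.indicator (fun _ => M) x ∂ν ≤ M * ν.real t := by
  rw [setIntegral_indicator ht, setIntegral_const, smul_eq_mul, mul_comm]
  gcongr
  exact inter_subset_right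

theorem exists_calibration_constants {p q γ η : ℝ} (hpq : p.HolderConjugate q) (hγ : 0 < γ)
    (hη : 0 < η) :
    ∃ κ > 0, ∃ K > 0, (κ * q) ^ (p - 1) = η ∧ κ * K ^ q = γ := by
  have hq : 0 < q := hpq.symm.pos
  have hκ : 0 < η ^ (p - 1)⁻¹ / q := by positivity
  refine ⟨_, hκ, (γ / (η ^ (p - 1)⁻¹ / q)) ^ q⁻¹, by positivity, ?_, ?_⟩
  · rw [div_mul_cancel₀ _ hq.ne', Real.rpow_inv_rpow hη.le hpq.sub_one_ne_zero]
  · rw [Real.rpow_inv_rpow (by positivity) hq.ne', mul_div_cancel₀ _ hκ.ne']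

/-- As long as a minimizer stays below `1 - h`, the measure of `{u > -1/2}` in a ball grows by a
fixed factor whenever the radius grows by a fixed amount. -/
theorem exists_measureReal_superlevel_growth (n : ℕ) {p m lam Lam h : ℝ} (hp : 1 < p)
    (hm : 1 < m) (hlam : 0 < lam) (hLam : 0 < Lam) (hh : 0 < h) :
    ∃ K > (0 : ℝ), ∃ μ > (0 : ℝ), ∀ W : ℝ → ℝ, IsAdmissiblePotential m lam Lam W →
      ∀ (Ω : Set (EuclideanSpace ℝ (Fin n))) (u : EuclideanSpace ℝ (Fin n) → ℝ),
        (∀ x, u x ∈ Icc (-1 : ℝ) 1) → LocLipOn Ω u → IsMinOfJW p W Ω u →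
        ∀ r > 0, closedBall (0 : EuclideanSpace ℝ (Fin n)) (r + K + 1) ⊆ Ω →
        (∀ x ∈ ball (0 : EuclideanSpace ℝ (Fin n)) (r + K), u x ≤ 1 - h) →
        (1 + μ) * volume.real (ball (0 : EuclideanSpace ℝ (Fin n)) r ∩ {x | -1 / 2 < u x}) ≤
          volume.real (ball (0 : EuclideanSpace ℝ (Fin n)) (r + K) ∩ {x | -1 / 2 < u x}) := by
  have hm0 : 0 < m := one_pos.trans hm
  have hp0 : 0 < p := one_pos.trans hp
  set q : ℝ := p / (p - 1) with hq
  have hpq : p.HolderConjugate q := Real.HolderConjugate.conjExponent hp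
  set γ : ℝ := lam * (h / 2) ^ m with hγ
  have hγ0 : 0 < γ := by positivity
  obtain ⟨c, hc0, hc1, hc⟩ : ∃ c > 0, c ≤ 1 / 4 ∧ Lam * (2 * c) ^ m ≤ γ / 4 := by
    refine ⟨min (1 / 4) ((γ / (4 * Lam)) ^ m⁻¹ / 2), by positivity, min_le_left _ _, ?_⟩
    have h1 : 2 * min (1 / 4) ((γ / (4 * Lam)) ^ m⁻¹ / 2) ≤ (γ / (4 * Lam)) ^ m⁻¹ := by
      linarith [min_le_right (1 / 4) ((γ / (4 * Lam)) ^ m⁻¹ / 2)]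
    calc _ ≤ Lam * ((γ / (4 * Lam)) ^ m⁻¹) ^ m := by gcongr
      _ = _ := by
        rw [Real.rpow_inv_rpow (by positivity) hm0.ne']
        field_simp
  set η : ℝ := min (lam * c ^ (m - 1)) (γ / 8) with hη
  have hη0 : 0 < η := by positivity
  set δ : ℝ := η / (3 * p * (n + 1)) with hδ
  have hδ0 : 0 < δ := by positivity
  have hδη : p * (n * (δ * 3)) ≤ η := by
    have h1 : δ * (3 * p * (n + 1)) = η := by rw [hδ]; field_simp
    nlinarith [mul_pos hδ0 hp0]
  obtain ⟨κ, hκ, K, hK, hκδ, hκK⟩ := exists_calibration_constants hpq (zero_lt_three (α := ℝ)) hδ0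
  set M : ℝ := Lam + γ with hM
  have hM0 : 0 < M := by positivity
  refine ⟨K, hK, γ / (2 * M), by positivity, fun W hW Ω u huI huL hmin r hr hΩ hu => ?_⟩
  set w : EuclideanSpace ℝ (Fin n) → ℝ := powerBarrier (-1 + c) κ q r with hw
  have hcw : ∀ x, -1 + c ≤ w x := le_powerBarrier hκ.le
  have hB : IsBarrier Ω u w (r + K) (r + K + 1) := by
    refine ⟨huI, huL, locallyLipschitz_powerBarrier _ _ _ hpq.symm.lt.le,
      fun x => by linarith [hcw x], fun x hx => ?_, by linarith, hΩ⟩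
    have h1 : κ * K ^ q ≤ κ * max (‖x‖ - r) 0 ^ q := by
      have := hpq.symm.nonneg
      gcongr
      exact le_max_of_le_left (by linarith)
    rw [hw, powerBarrier]
    linarith
  have hXL : LipschitzWith (‖δ‖₊ * 3)
      fun x : EuclideanSpace ℝ (Fin n) => δ • radialExcess r x :=
    (lipschitzWith_smul δ).comp (lipschitzWith_radialExcess hr)
  have hcal : ∀ᵐ x : EuclideanSpace ℝ (Fin n),
      fderiv ℝ w x (δ • radialExcess r x) = ‖fderiv ℝ w x‖ ^ p ∧
        ‖δ • radialExcess r x‖ ^ q = ‖fderiv ℝ w x‖ ^ p := by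
    have h1 : volume (sphere (0 : EuclideanSpace ℝ (Fin n)) r) = 0 :=
      Measure.addHaar_sphere_of_ne_zero _ _ hr.ne'
    filter_upwards [compl_mem_ae_iff.2 h1] with x hx
    rw [← hκδ]
    exact fderiv_powerBarrier_radialExcess hpq hκ hr fun h' => hx (mem_sphere_zero_iff_norm.2 h')
  have hcoef : p * (n * ((‖δ‖₊ * 3 : NNReal) : ℝ)) ≤ η := by
    simpa [abs_of_pos hδ0] using hδη
  set A : Set (EuclideanSpace ℝ (Fin n)) := ball 0 r ∩ {x | -1 / 2 < u x} with hA
  set A' : Set (EuclideanSpace ℝ (Fin n)) := ball 0 (r + K) ∩ {x | -1 / 2 < u x} with hA'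
  have hAm : MeasurableSet A := (isOpen_ball_inter_superlevel huL
    ((closedBall_subset_closedBall (by linarith)).trans hΩ) _).measurableSet
  have hA'm : MeasurableSet A' := (isOpen_ball_inter_superlevel huL
    ((closedBall_subset_closedBall (by linarith)).trans hΩ) _).measurableSet
  have hAA' : A ⊆ A' := inter_subset_inter_left _ (ball_subset_ball (by linarith))
  have hA'fin : volume A' ≠ ⊤ := measure_ball_inter_ne_top _ _
  have hAfin : volume A ≠ ⊤ := measure_ball_inter_ne_top _ _
  have hdfin : volume (A' \ A) ≠ ⊤ := ((measure_mono sdiff_subset).trans_lt hA'fin.lt_top).ne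
  have hwA : ∀ x ∈ ball (0 : EuclideanSpace ℝ (Fin n)) r, w x = -1 + c := fun x hx =>
    powerBarrier_of_norm_le hpq.symm.ne_zero (mem_ball_zero_iff.1 hx).le
  have hAS : A ⊆ {x | w x < u x} := fun x hx => by
    have h1 : -1 / 2 < u x := hx.2
    show w x < u x
    rw [hwA x hx.1]
    linarith
  have hi1 : Integrable ((A' \ A).indicator fun _ => M)
      (volume : Measure (EuclideanSpace ℝ (Fin n))) :=
    (integrable_indicator_iff (hA'm.diff hAm)).2 (integrableOn_const hdfin)
  have hi2 : Integrable (A.indicator fun _ => γ / 2)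
      (volume : Measure (EuclideanSpace ℝ (Fin n))) :=
    (integrable_indicator_iff hAm).2 (integrableOn_const hAfin)
  have key := hB.setIntegral_nonneg hpq hm0 hLam hW hmin hXL hcal
    (G := fun x => (A' \ A).indicator (fun _ => M) x - A.indicator (fun _ => γ / 2) x)
    (hi1.sub hi2).integrableOn (fun x hx => by
      have hu1 := huI x
      have h0 : p * (n * ((‖δ‖₊ * 3 : NNReal) : ℝ)) * (u x - w x) ≤ η * (u x - w x) :=
        mul_le_mul_of_nonneg_right hcoef (by linarith)
      have hxball := hB.setOf_lt_subset_ball hx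
      have hγle : η * (u x - w x) ≤ γ / 4 := by
        have h1 : η ≤ γ / 8 := min_le_right _ _
        nlinarith [hcw x, hu1.2]
      by_cases hux : -1 / 2 < u x
      · by_cases hxr : x ∈ ball (0 : EuclideanSpace ℝ (Fin n)) r
        · have hxA : x ∈ A := ⟨hxr, hux⟩
          rw [indicator_of_notMem (fun h' => h'.2 hxA), indicator_of_mem hxA, hwA x hxr] at *
          have hux' := hu x hxball
          have h1 : γ ≤ W (u x) := by
            refine le_trans ?_ (hW.mul_rpow_le ⟨by linarith, by linarith⟩)
            rw [hγ]
            gcongr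
            nlinarith
          have h2 : W (-1 + c) ≤ γ / 4 := by
            refine (hW.le_mul_rpow hm0 ⟨by linarith, by linarith⟩).trans (le_trans ?_ hc)
            gcongr
            · nlinarith
            · nlinarith
          linarith
        · have hxA : x ∉ A := fun h' => hxr h'.1
          rw [indicator_of_mem (show x ∈ A' \ A from ⟨⟨hxball, hux⟩, hxA⟩),
            indicator_of_notMem hxA]
          have h1 := hW.nonneg hu1
          have h2 : W (w x) ≤ Lam := hW.le_const hm0 hLam ⟨by linarith [hcw x], by linarith [hu1.2]⟩
          linarith
      · rw [indicator_of_notMem (fun h' => hux h'.1.2), indicator_of_notMem (fun h' => hux h'.2)]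
        have h1 := hW.mul_sub_le_sub hm.le hlam.le hc0 (hcw x) hx.le (not_lt.1 hux)
        have h2 : η * (u x - w x) ≤ lam * c ^ (m - 1) * (u x - w x) :=
          mul_le_mul_of_nonneg_right (min_le_left _ _) (by linarith)
        linarith)
  rw [integral_sub hi1.integrableOn hi2.integrableOn] at key
  have h1 := setIntegral_indicator_const_le (ν := volume) (s := {x | w x < u x}) hM0.le
    (hA'm.diff hAm) hdfin
  have h2 : ∫ x in {x | w x < u x}, A.indicator (fun _ => γ / 2) x = γ / 2 * volume.real A := by
    rw [setIntegral_indicator hAm, inter_eq_self_of_subset_right hAS, setIntegral_const,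
      smul_eq_mul, mul_comm]
  rw [measureReal_sdiff hAA' hAm] at h1
  have h3 : M * ((1 + γ / (2 * M)) * volume.real A) ≤ M * volume.real A' := by
    have : M * ((1 + γ / (2 * M)) * volume.real A) = M * volume.real A + γ / 2 * volume.real A := by
      field_simp
    linarith
  exact le_of_mul_le_mul_left h3 hM0

end DensityGrowth
/-- A minimizer vanishing at the origin gets arbitrarily close to `1` in a
sufficiently large ball (Lemma 3.2 in the paper). -/
theorem minimizer_quickly_tends_to_one
    (n : ℕ) (hn : 2 ≤ n) (p m lam Lam : ℝ)
    (hp : 1 < p) (hpm : p < m) (hlam : 0 < lam) (hlL : lam ≤ Lam)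
    (h : ℝ) (hh0 : 0 < h) (hh1 : h < 1) :
    ∃ ρ > (0 : ℝ),
      ∀ W : ℝ → ℝ, IsAdmissiblePotential m lam Lam W →
      ∀ Ω : Set (EuclideanSpace ℝ (Fin n)), IsOpen Ω →
        (0 : EuclideanSpace ℝ (Fin n)) ∈ Ω →
      ∀ u : EuclideanSpace ℝ (Fin n) → ℝ,
        (∀ x, u x ∈ Icc (-1 : ℝ) 1) → LocLipOn Ω u → IsMinOfJW p W Ω u →
        u 0 = 0 →
        ball (0 : EuclideanSpace ℝ (Fin n)) (2 * ρ) ⊆ Ω →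
        1 - h ≤ sSup (u '' ball (0 : EuclideanSpace ℝ (Fin n)) ρ) := by
  have hm : 1 < m := hp.trans hpm
  have hLam : 0 < Lam := hlam.trans_le hlL
  obtain ⟨c, hc, hbase⟩ := exists_pos_le_measureReal_superlevel n (p := p) (m := m) (lam := lam)
    (Lam := Lam) (by lia) hp (one_pos.trans hm) hLam
  obtain ⟨K, hK, μ, hμ, hgrow⟩ := exists_measureReal_superlevel_growth n hp hm hlam hLam hh0
  set ω : ℝ := volume.real (ball (0 : EuclideanSpace ℝ (Fin n)) 1) with hω
  obtain ⟨J, hJ⟩ : ∃ J : ℕ, (1 + J * K) ^ n * ω < (1 + μ) ^ J * c := by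
    have h1 := (tendsto_pow_const_div_const_pow_of_one_lt n
      (show 1 < 1 + μ by linarith)).mul_const ((1 + K) ^ n * ω)
    rw [zero_mul] at h1
    obtain ⟨J, hJ, hJ1⟩ := ((h1.eventually (gt_mem_nhds hc)).and
      (Filter.eventually_ge_atTop 1)).exists
    refine ⟨J, ?_⟩
    have hpos : 0 < (1 + μ) ^ J := by positivity
    have hJ1' : (1 : ℝ) ≤ J := by exact_mod_cast hJ1
    calc (1 + J * K) ^ n * ω ≤ (J * (1 + K)) ^ n * ω := by
          gcongr
          linarith
      _ = (1 + μ) ^ J * ((J : ℝ) ^ n / (1 + μ) ^ J * ((1 + K) ^ n * ω)) := by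
          rw [mul_pow]
          field_simp
      _ < _ := by gcongr
  refine ⟨1 + J * K + 1, by positivity, fun W hW Ω _ _ u huI huL hmin hu0 hball => ?_⟩
  by_contra! hlt
  have hΩ : ∀ s ≤ 1 + J * K + 1, closedBall (0 : EuclideanSpace ℝ (Fin n)) s ⊆ Ω := by
    intro s hs
    refine (closedBall_subset_ball ?_).trans hball
    have : 0 < 1 + J * K + 1 := by positivity
    linarith
  have hu : ∀ x ∈ ball (0 : EuclideanSpace ℝ (Fin n)) (1 + J * K + 1), u x ≤ 1 - h := fun x hx =>
    (le_csSup ⟨1, by rintro _ ⟨y, -, rfl⟩; exact (huI y).2⟩ (mem_image_of_mem u hx)).trans hlt.le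
  have hind : ∀ j ≤ J, (1 + μ) ^ j * c ≤
      volume.real (ball (0 : EuclideanSpace ℝ (Fin n)) (1 + j * K) ∩ {x | -1 / 2 < u x}) := by
    intro j
    induction j with
    | zero =>
      intro _
      simpa using hbase W hW Ω u huI huL hmin hu0
        (hΩ 1 (by linarith [show 0 ≤ J * K by positivity]))
    | succ j ih =>
      intro hj
      have hle : ((j + 1 : ℕ) : ℝ) * K ≤ J * K := by gcongr
      have he : 1 + ((j + 1 : ℕ) : ℝ) * K = 1 + j * K + K := by push_cast; ring
      have h1 := hgrow W hW Ω u huI huL hmin (1 + j * K) (by positivity)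
        (hΩ _ (by linarith)) fun x hx => hu x (ball_subset_ball (by linarith) hx)
      rw [he, pow_succ', mul_assoc]
      refine le_trans ?_ h1
      gcongr
      exact ih (by lia)
  have hvol : volume.real (ball (0 : EuclideanSpace ℝ (Fin n)) (1 + J * K) ∩ {x | -1 / 2 < u x}) ≤
      (1 + J * K) ^ n * ω := by
    rw [hω, ← measureReal_ball_zero_eq _ (by positivity)]
    exact measureReal_mono inter_subset_left measure_ball_lt_top.ne
  linarith [hind J le_rfl]
end
end

section
/- Let u be a Q-minimizer of J on Ω. There exists a constant C = C(n,p,m,Q) > 0 such that for every R ≥ 2 with the closure of B_{R+2} contained in Ω, one has J(u, B_R) ≤ C·R^{n−1}; in particular ∫_{B_R} W(u) dx ≤ C·R^{n−1}. -/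
open MeasureTheory Metric Set

noncomputable section

/-- The energy `J(v,A) = ∫_A (|∇v|^p + (1-v²)^m) dx`. -/
def Jpm {n : ℕ} (p m : ℝ) (v : EuclideanSpace ℝ (Fin n) → ℝ)
    (A : Set (EuclideanSpace ℝ (Fin n))) : ℝ :=
  ∫ x in A, (‖gradient v x‖ ^ p + (1 - (v x) ^ 2) ^ m)

/-- `u` is a `Q`-minimizer of `Jpm p m` in `Ω`. -/
def IsQMinOfJpm {n : ℕ} (p m Q : ℝ) (Ω : Set (EuclideanSpace ℝ (Fin n)))
    (u : EuclideanSpace ℝ (Fin n) → ℝ) : Prop :=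
  ∀ Ω' : Set (EuclideanSpace ℝ (Fin n)), IsOpen Ω' → Bornology.IsBounded Ω' →
    closure Ω' ⊆ Ω →
    ∀ v : EuclideanSpace ℝ (Fin n) → ℝ,
      (∀ x, v x ∈ Icc (-1 : ℝ) 1) → LocLipOn Ω v →
      (∀ x ∈ Ω \ Ω', v x = u x) →
      Jpm p m u Ω' ≤ Q * Jpm p m v Ω'

/-- A one-sided linear bound at `x` controls the gradient at `x`. -/
lemma norm_gradient_le_of_forall_le {E : Type*} [NormedAddCommGroup E] [InnerProductSpace ℝ E]
    [CompleteSpace E] {v : E → ℝ} {x : E} {L : ℝ} (hL : 0 ≤ L)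
    (h : ∀ y, v y ≤ v x + L * ‖y - x‖) : ‖gradient v x‖ ≤ L := by
  by_cases hd : DifferentiableAt ℝ v x
  · set g := gradient v x with hg
    have hD := (hd.hasGradientAt.hasFDerivAt.hasLineDerivAt g).tendsto_slope_zero_right
    rw [← hg, InnerProductSpace.toDual_apply_apply, real_inner_self_eq_norm_sq] at hD
    have hle : ‖g‖ ^ 2 ≤ L * ‖g‖ := by
      refine le_of_tendsto hD ?_
      filter_upwards [self_mem_nhdsWithin] with t (ht : 0 < t)
      have h1 := h (x + t • g)
      rw [add_sub_cancel_left, norm_smul, Real.norm_of_nonneg ht.le] at h1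
      rw [smul_eq_mul, inv_mul_le_iff₀ ht]
      linarith
    rcases (norm_nonneg g).eq_or_lt with h0 | h0
    · rw [← h0]; exact hL
    · nlinarith
  · rw [gradient_eq_zero_of_not_differentiableAt hd, norm_zero]
    exact hL

lemma LocLipOn.continuousAt {n : ℕ} {Ω : Set (EuclideanSpace ℝ (Fin n))}
    {u : EuclideanSpace ℝ (Fin n) → ℝ} (hu : LocLipOn Ω u) {x : EuclideanSpace ℝ (Fin n)}
    (hx : x ∈ Ω) : ContinuousAt u x := by
  obtain ⟨K, U, hU, hK⟩ := hu x hx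
  exact hK.continuousOn.continuousAt hU

lemma energyDensity_nonneg {n : ℕ} (p m : ℝ) {u : EuclideanSpace ℝ (Fin n) → ℝ}
    (hu : ∀ x, u x ∈ Icc (-1 : ℝ) 1) (x : EuclideanSpace ℝ (Fin n)) :
    0 ≤ ‖gradient u x‖ ^ p ∧ 0 ≤ (1 - u x ^ 2) ^ m := by
  refine ⟨by positivity, Real.rpow_nonneg ?_ _⟩
  have := hu x
  nlinarith [this.1, this.2]

lemma potential_le_one {m τ : ℝ} (hm : 0 ≤ m) (hτ : τ ∈ Icc (-1 : ℝ) 1) :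
    (1 - τ ^ 2) ^ m ≤ 1 :=
  Real.rpow_le_one (by nlinarith [hτ.1, hτ.2]) (by nlinarith [sq_nonneg τ]) hm

lemma measurable_gradient {n : ℕ} (u : EuclideanSpace ℝ (Fin n) → ℝ) :
    Measurable (gradient u) :=
  (InnerProductSpace.toDual ℝ (EuclideanSpace ℝ (Fin n))).symm.continuous.measurable.comp
    (measurable_fderiv ℝ u)

/-- The energy density of a locally Lipschitz function is integrable on compact subsets. -/
lemma LocLipOn.integrableOn_energyDensity {n : ℕ} {p m : ℝ} (hp : 0 ≤ p) (hm : 0 ≤ m)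
    {Ω : Set (EuclideanSpace ℝ (Fin n))} {u : EuclideanSpace ℝ (Fin n) → ℝ} (hu : LocLipOn Ω u)
    {S : Set (EuclideanSpace ℝ (Fin n))} (hS : IsCompact S) (hSΩ : S ⊆ Ω) :
    IntegrableOn (fun x ↦ ‖gradient u x‖ ^ p) S ∧
      IntegrableOn (fun x ↦ (1 - u x ^ 2) ^ m) S := by
  constructor
  · refine LocallyIntegrableOn.integrableOn_isCompact (fun x hx ↦ ?_) hS
    obtain ⟨K, U, hU, hK⟩ := hu x (hSΩ hx)
    obtain ⟨r, hr, hrU⟩ := Metric.mem_nhds_iff.1 hU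
    refine ⟨ball x r, mem_nhdsWithin_of_mem_nhds (ball_mem_nhds x hr), ?_⟩
    refine Measure.integrableOn_of_bounded (M := (K : ℝ) ^ p) measure_ball_lt_top.ne
      ((measurable_gradient u).norm.pow_const p).aestronglyMeasurable ?_
    refine (ae_restrict_mem measurableSet_ball).mono fun y hy ↦ ?_
    rw [Real.norm_of_nonneg (by positivity)]
    refine Real.rpow_le_rpow (norm_nonneg _) ?_ hp
    rw [gradient, LinearIsometryEquiv.norm_map]
    exact norm_fderiv_le_of_lipschitzOn ℝ
      (Filter.mem_of_superset (isOpen_ball.mem_nhds hy) hrU) hK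
  · have hc : ContinuousOn u S := fun x hx ↦ (hu.continuousAt (hSΩ hx)).continuousWithinAt
    exact ((continuousOn_const.sub (hc.pow 2)).rpow_const
      fun _ _ ↦ Or.inr hm).integrableOn_compact hS

/-- The radial barrier equal to `-1` on `B_s`, growing linearly with slope `L` outside. -/
def radialBarrier {n : ℕ} (L s : ℝ) (x : EuclideanSpace ℝ (Fin n)) : ℝ :=
  max (-1) (L * (‖x‖ - s) - 1)

lemma radialBarrier_le_add {n : ℕ} {L : ℝ} (hL : 0 ≤ L) (s : ℝ)
    (x y : EuclideanSpace ℝ (Fin n)) :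
    radialBarrier L s y ≤ radialBarrier L s x + L * ‖y - x‖ := by
  have h1 : L * ‖y‖ ≤ L * (‖x‖ + ‖y - x‖) := by
    gcongr
    have := norm_add_le x (y - x)
    rwa [add_sub_cancel] at this
  have h2 : 0 ≤ L * ‖y - x‖ := by positivity
  unfold radialBarrier
  refine max_le ?_ ?_
  · linarith [le_max_left (-1) (L * (‖x‖ - s) - 1)]
  · linarith [le_max_right (-1) (L * (‖x‖ - s) - 1)]

lemma lipschitzWith_radialBarrier {n : ℕ} {L : ℝ} (hL : 0 ≤ L) (s : ℝ) :
    LipschitzWith L.toNNReal (radialBarrier (n := n) L s) := by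
  refine LipschitzWith.of_le_add_mul _ fun x y ↦ ?_
  rw [Real.coe_toNNReal _ hL, dist_eq_norm]
  exact radialBarrier_le_add hL s y x

lemma LocLipOn.min_lipschitz {n : ℕ} {Ω : Set (EuclideanSpace ℝ (Fin n))}
    {u ψ : EuclideanSpace ℝ (Fin n) → ℝ} (hu : LocLipOn Ω u) {L : NNReal}
    (hψ : LipschitzWith L ψ) : LocLipOn Ω (fun x ↦ min (u x) (ψ x)) := by
  intro x hx
  obtain ⟨K, U, hU, hK⟩ := hu x hx
  refine ⟨max K L, U, hU, LipschitzOnWith.of_dist_le_mul fun a ha b hb ↦ ?_⟩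
  have h1 := hK.dist_le_mul a ha b hb
  have h2 := hψ.dist_le_mul a b
  rw [Real.dist_eq] at h1 h2 ⊢
  refine (abs_min_sub_min_le_max _ _ _ _).trans (max_le (h1.trans ?_) (h2.trans ?_))
  · gcongr; exact le_max_left _ _
  · gcongr; exact le_max_right _ _

/-- Comparison of a `Q`-minimizer with its truncation by a radial barrier. -/
lemma IsQMinOfJpm.energy_ball_le {n : ℕ} {p m Q : ℝ} (hp : 0 < p) (hm : 0 < m) (hQ : 0 ≤ Q)
    {Ω : Set (EuclideanSpace ℝ (Fin n))}
    {u : EuclideanSpace ℝ (Fin n) → ℝ} (hu1 : ∀ x, u x ∈ Icc (-1 : ℝ) 1) (hu : LocLipOn Ω u)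
    (hmin : IsQMinOfJpm p m Q Ω u) {s t : ℝ} (hst : s < t)
    (ht : closedBall (0 : EuclideanSpace ℝ (Fin n)) t ⊆ Ω) :
    Jpm p m u (ball 0 t) ≤ Q * (Jpm p m u (ball 0 t) - Jpm p m u (ball 0 s) +
      ((2 / (t - s)) ^ p + 1) *
        volume.real (ball (0 : EuclideanSpace ℝ (Fin n)) t \ ball 0 s)) := by
  have hts : 0 < t - s := sub_pos.2 hst
  set L := 2 / (t - s) with hLdef
  have hL : 0 ≤ L := by positivity
  set ψ : EuclideanSpace ℝ (Fin n) → ℝ := radialBarrier L s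
  have hψ : LipschitzWith L.toNNReal ψ := lipschitzWith_radialBarrier hL s
  set v : EuclideanSpace ℝ (Fin n) → ℝ := fun x ↦ min (u x) (ψ x)
  have hv1 : ∀ x, v x ∈ Icc (-1 : ℝ) 1 := fun x ↦
    ⟨le_min (hu1 x).1 (le_max_left _ _), (min_le_left _ _).trans (hu1 x).2⟩
  have hvs : ∀ x ∈ ball (0 : EuclideanSpace ℝ (Fin n)) s, v x = -1 := by
    intro x hx
    rw [mem_ball_zero_iff] at hx
    refine le_antisymm ((min_le_right _ _).trans (max_le le_rfl ?_)) (hv1 x).1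
    have : L * (‖x‖ - s) ≤ 0 := mul_nonpos_of_nonneg_of_nonpos hL (by linarith)
    linarith
  have hvt : ∀ x ∈ Ω \ ball (0 : EuclideanSpace ℝ (Fin n)) t, v x = u x := by
    intro x hx
    have hx2 : t ≤ ‖x‖ := by simpa using hx.2
    refine min_eq_left ((hu1 x).2.trans ((le_max_right _ _).trans' ?_))
    have h1 : L * (t - s) = 2 := by rw [hLdef]; field_simp
    have h2 : L * (t - s) ≤ L * (‖x‖ - s) := by gcongr
    linarith
  have hcl : closure (ball (0 : EuclideanSpace ℝ (Fin n)) t) ⊆ Ω :=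
    closure_ball_subset_closedBall.trans ht
  have hJ := hmin (ball 0 t) isOpen_ball isBounded_ball hcl v hv1 (hu.min_lipschitz hψ) hvt
  refine hJ.trans (mul_le_mul_of_nonneg_left ?_ hQ)
  set f : EuclideanSpace ℝ (Fin n) → ℝ := fun x ↦ ‖gradient u x‖ ^ p + (1 - u x ^ 2) ^ m
    with hf
  have hfi : IntegrableOn f (ball 0 t) := by
    have := hu.integrableOn_energyDensity hp.le hm.le (isCompact_closedBall 0 t) ht
    exact (this.1.add this.2).mono_set ball_subset_closedBall
  set A := ball (0 : EuclideanSpace ℝ (Fin n)) t \ ball 0 s with hA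
  have hAm : MeasurableSet A := measurableSet_ball.diff measurableSet_ball
  have hAfin : volume A ≠ ⊤ :=
    ((measure_mono sdiff_subset).trans_lt measure_ball_lt_top).ne
  have hci : IntegrableOn (fun _ ↦ L ^ p + 1) A := integrableOn_const hAfin
  have hgi : IntegrableOn (fun x ↦ f x + (L ^ p + 1)) A := (hfi.mono_set sdiff_subset).add hci
  have hbound : ∀ x ∈ ball (0 : EuclideanSpace ℝ (Fin n)) t,
      ‖gradient v x‖ ^ p + (1 - v x ^ 2) ^ m ≤
        A.indicator (fun x ↦ f x + (L ^ p + 1)) x := by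
    intro x hx
    by_cases hxs : x ∈ ball (0 : EuclideanSpace ℝ (Fin n)) s
    · have hev : v =ᶠ[nhds x] fun _ ↦ (-1 : ℝ) :=
        Filter.eventually_of_mem (isOpen_ball.mem_nhds hxs) hvs
      have hg : gradient v x = 0 := by
        rw [gradient, hev.fderiv_eq]; simp
      rw [indicator_of_notMem (fun h ↦ h.2 hxs), hg, hvs x hxs]
      simp [Real.zero_rpow hp.ne', Real.zero_rpow hm.ne']
    · rw [indicator_of_mem (show x ∈ A from ⟨hx, hxs⟩)]
      have hW := potential_le_one hm.le (hv1 x)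
      have hu0 := energyDensity_nonneg p m hu1 x
      have hLp : 0 ≤ L ^ p := by positivity
      have hgrad : ‖gradient v x‖ ^ p ≤ ‖gradient u x‖ ^ p + L ^ p := by
        rcases lt_or_ge (u x) (ψ x) with hlt | hge
        · have hev : v =ᶠ[nhds x] u := by
            filter_upwards [(hu.continuousAt (ht (ball_subset_closedBall hx))).eventually_lt
              hψ.continuous.continuousAt hlt] with y hy
            exact min_eq_left hy.le
          have : gradient v x = gradient u x := by rw [gradient, hev.fderiv_eq, gradient]
          rw [this]
          linarith
        · have : ‖gradient v x‖ ≤ L := by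
            refine norm_gradient_le_of_forall_le hL fun y ↦ (min_le_right _ _).trans ?_
            have hvx : v x = ψ x := min_eq_right hge
            rw [hvx]
            exact radialBarrier_le_add hL s x y
          linarith [Real.rpow_le_rpow (norm_nonneg _) this hp.le]
      simp only [hf]
      linarith
  have hAt : A ⊆ ball 0 t := sdiff_subset
  calc Jpm p m v (ball 0 t)
      ≤ ∫ x in ball 0 t, A.indicator (fun x ↦ f x + (L ^ p + 1)) x := by
        refine integral_mono_of_nonneg (Filter.Eventually.of_forall fun x ↦ ?_) ?_ ?_
        · have := energyDensity_nonneg p m hv1 x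
          exact add_nonneg this.1 this.2
        · exact ((integrable_indicator_iff hAm).2 hgi).integrableOn
        · exact (ae_restrict_mem measurableSet_ball).mono hbound
    _ = ∫ x in A, (f x + (L ^ p + 1)) := by
        rw [setIntegral_indicator hAm, inter_eq_right.2 hAt]
    _ = (∫ x in A, f x) + (L ^ p + 1) * volume.real A := by
        rw [integral_add (hfi.mono_set sdiff_subset) hci, setIntegral_const, smul_eq_mul,
          mul_comm (volume.real A)]
    _ = _ := by
        have hsub : ball (0 : EuclideanSpace ℝ (Fin n)) s ⊆ ball 0 t :=
          ball_subset_ball hst.le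
        rw [hA, setIntegral_sdiff measurableSet_ball hfi hsub]
        rfl

lemma volume_real_annulus_le {n : ℕ} {R : ℝ} (hR : 1 ≤ R) :
    volume.real (ball (0 : EuclideanSpace ℝ (Fin n)) (R + 1) \ ball 0 R) ≤
      volume.real (ball (0 : EuclideanSpace ℝ (Fin n)) 1) * (n * 2 ^ (n - 1)) *
        R ^ (n - 1) := by
  have hb : ∀ r : ℝ, 0 < r → volume.real (ball (0 : EuclideanSpace ℝ (Fin n)) r) =
      r ^ n * volume.real (ball (0 : EuclideanSpace ℝ (Fin n)) 1) := by
    intro r hr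
    rw [Measure.real, Measure.addHaar_ball_of_pos _ _ hr, ENNReal.toReal_mul,
      ENNReal.toReal_ofReal (by positivity), finrank_euclideanSpace_fin, Measure.real]
  rw [measureReal_sdiff (ball_subset_ball (by linarith)) measurableSet_ball, hb (R + 1) (by linarith),
    hb R (by linarith), ← sub_mul]
  have hpow : (R + 1) ^ n - R ^ n ≤ n * 2 ^ (n - 1) * R ^ (n - 1) := by
    have h1 : (R + 1) ^ n - R ^ n ≤ n * (R + 1) ^ (n - 1) := by
      have := (le_abs_self _).trans (abs_pow_sub_pow_le (R + 1) R n)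
      rw [add_sub_cancel_left, abs_one, one_mul, abs_of_nonneg (by linarith : 0 ≤ R + 1),
        abs_of_nonneg (by linarith : 0 ≤ R), max_eq_left (by linarith)] at this
      exact this
    have h2 : (R + 1) ^ (n - 1) ≤ (2 * R) ^ (n - 1) := by gcongr; linarith
    rw [mul_pow] at h2
    calc _ ≤ _ := h1
      _ ≤ n * (2 ^ (n - 1) * R ^ (n - 1)) := by gcongr
      _ = _ := by ring
  calc _ ≤ n * 2 ^ (n - 1) * R ^ (n - 1) *
        volume.real (ball (0 : EuclideanSpace ℝ (Fin n)) 1) := by gcongr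
    _ = _ := by ring

/-- Hole-filling iteration on `[R, R + 1]`. The constant depends only on `θ` and `p`. -/
lemma exists_holeFilling_const {p θ : ℝ} (hp : 0 < p) (hθ : 0 ≤ θ) (hθ1 : θ < 1) :
    ∃ c > (0 : ℝ), ∀ (φ : ℝ → ℝ) (R B M : ℝ), 0 ≤ M →
      (∀ s ∈ Icc R (R + 1), φ s ≤ B) →
      (∀ s ∈ Icc R (R + 1), ∀ t ∈ Icc R (R + 1), s < t →
        φ s ≤ θ * φ t + ((2 / (t - s)) ^ p + 1) * M) → φ R ≤ c * M := by
  set σ := (1 + θ) / 2 with hσ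
  have hσ0 : 0 < σ := by positivity
  have hσ1 : σ < 1 := by rw [hσ]; linarith
  set τ := σ ^ p⁻¹ with hτ
  have hτ0 : 0 < τ := by positivity
  have hτ1 : τ < 1 := Real.rpow_lt_one hσ0.le hσ1 (by positivity)
  have hτp : τ ^ p = σ := by rw [hτ, ← Real.rpow_mul hσ0.le, inv_mul_cancel₀ hp.ne', Real.rpow_one]
  have hτ2 : 0 < 1 - τ := by linarith
  set D := (2 / (1 - τ)) ^ p + 1 with hD
  have hD0 : 0 < D := by positivity
  set q := θ / σ with hq
  have hq0 : 0 ≤ q := by positivity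
  have hq1 : q < 1 := by rw [hq, div_lt_one hσ0, hσ]; linarith
  have hq2 : 0 < 1 - q := by linarith
  refine ⟨D / (1 - q), by positivity, fun φ R B M hM hB hφ ↦ ?_⟩
  set T : ℕ → ℝ := fun k ↦ R + 1 - τ ^ k with hT
  have hTmem : ∀ k, T k ∈ Icc R (R + 1) := fun k ↦ by
    have h1 : τ ^ k ≤ 1 := pow_le_one₀ hτ0.le hτ1.le
    have h2 : 0 < τ ^ k := by positivity
    constructor <;> simp only [hT] <;> linarith
  have hstep : ∀ k, φ (T k) ≤ θ * φ (T (k + 1)) + D * M * (σ ^ k)⁻¹ := by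
    intro k
    have hdiff : T (k + 1) - T k = (1 - τ) * τ ^ k := by simp only [hT]; ring
    have hpos : 0 < T (k + 1) - T k := by rw [hdiff]; positivity
    refine (hφ _ (hTmem k) _ (hTmem (k + 1)) (sub_pos.1 hpos)).trans ?_
    have h1 : (2 / (T (k + 1) - T k)) ^ p = (2 / (1 - τ)) ^ p * (σ ^ k)⁻¹ := by
      rw [hdiff, ← div_div, div_eq_mul_inv (2 / (1 - τ)),
        Real.mul_rpow (by positivity) (by positivity), Real.inv_rpow (by positivity),
        ← Real.rpow_natCast, ← Real.rpow_mul hτ0.le, mul_comm (k : ℝ), Real.rpow_mul hτ0.le, hτp,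
        Real.rpow_natCast]
    have h2 : 1 ≤ (σ ^ k)⁻¹ := (one_le_inv₀ (by positivity)).2 (pow_le_one₀ hσ0.le hσ1.le)
    rw [h1]
    have h3 : (2 / (1 - τ)) ^ p * (σ ^ k)⁻¹ + 1 ≤ D * (σ ^ k)⁻¹ := by rw [hD]; linarith
    nlinarith [mul_le_mul_of_nonneg_right h3 hM]
  have hiter : ∀ k, φ R ≤ θ ^ k * φ (T k) + D * M * ∑ i ∈ Finset.range k, q ^ i := by
    intro k
    induction k with
    | zero => simp [hT]
    | succ k ih =>
      have h1 := mul_le_mul_of_nonneg_left (hstep k) (pow_nonneg hθ k)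
      have h2 : q ^ k = θ ^ k * (σ ^ k)⁻¹ := by rw [hq, div_pow, div_eq_mul_inv]
      rw [Finset.sum_range_succ, h2, pow_succ]
      linarith
  have hlim : Filter.Tendsto (fun k : ℕ ↦ θ ^ k * B + D / (1 - q) * M) Filter.atTop
      (nhds (0 * B + D / (1 - q) * M)) :=
    ((tendsto_pow_atTop_nhds_zero_of_lt_one hθ hθ1).mul_const B).add_const _
  rw [zero_mul, zero_add] at hlim
  refine ge_of_tendsto' hlim fun k ↦ (hiter k).trans ?_
  have h1 : ∑ i ∈ Finset.range k, q ^ i ≤ (1 - q)⁻¹ := by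
    rw [← tsum_geometric_of_lt_one hq0 hq1]
    exact (summable_geometric_of_lt_one hq0 hq1).sum_le_tsum _ fun i _ ↦ pow_nonneg hq0 i
  have h2 := mul_le_mul_of_nonneg_left (hB _ (hTmem k)) (pow_nonneg hθ k)
  have h3 := mul_le_mul_of_nonneg_left h1 (mul_nonneg hD0.le hM)
  have h4 : D * M * (1 - q)⁻¹ = D / (1 - q) * M := by ring
  linarith

/-- The basic energy growth estimate `J(u, B_R) ≤ C R^{n-1}`
(estimate (2.3) in the paper). -/
theorem energy_upper_bound
    (n : ℕ) (hn : 2 ≤ n) (p m Q : ℝ)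
    (hp : 1 < p) (hpm : p < m) (hQ : 1 ≤ Q) :
    ∃ C > (0 : ℝ),
      ∀ Ω : Set (EuclideanSpace ℝ (Fin n)), IsOpen Ω →
      ∀ u : EuclideanSpace ℝ (Fin n) → ℝ,
        (∀ x, u x ∈ Icc (-1 : ℝ) 1) → LocLipOn Ω u → IsQMinOfJpm p m Q Ω u →
        ∀ R : ℝ, 2 ≤ R →
          closure (ball (0 : EuclideanSpace ℝ (Fin n)) (R + 2)) ⊆ Ω →
          Jpm p m u (ball (0 : EuclideanSpace ℝ (Fin n)) R) ≤ C * R ^ (n - 1) ∧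
          (∫ x in ball (0 : EuclideanSpace ℝ (Fin n)) R, (1 - (u x) ^ 2) ^ m) ≤
            C * R ^ (n - 1) := by
  have hp0 : 0 < p := by linarith
  have hm0 : 0 < m := by linarith
  have hQ0 : 0 < Q := by linarith
  obtain ⟨c, hc, hiter⟩ := exists_holeFilling_const (θ := Q / (Q + 1)) hp0 (by positivity)
    ((div_lt_one (by positivity)).2 (by linarith))
  set ω := volume.real (ball (0 : EuclideanSpace ℝ (Fin n)) 1)
  have hω0 : 0 < ω :=
    ENNReal.toReal_pos (measure_ball_pos volume _ one_pos).ne' measure_ball_lt_top.ne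
  have hn0 : 0 < n := by omega
  refine ⟨c * (ω * (n * 2 ^ (n - 1))), by positivity, ?_⟩
  intro Ω hΩ u hu1 hu hmin R hR hRΩ
  rw [closure_ball _ (by linarith)] at hRΩ
  have hint : ∀ t ≤ R + 2, IntegrableOn (fun x ↦ ‖gradient u x‖ ^ p) (ball 0 t) ∧
      IntegrableOn (fun x ↦ (1 - u x ^ 2) ^ m) (ball 0 t) := by
    intro t ht
    have hsub := ball_subset_closedBall.trans
      (closedBall_subset_closedBall (x := (0 : EuclideanSpace ℝ (Fin n))) ht)
    have := hu.integrableOn_energyDensity hp0.le hm0.le (isCompact_closedBall 0 (R + 2)) hRΩ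
    exact ⟨this.1.mono_set hsub, this.2.mono_set hsub⟩
  have hmono : ∀ s t, s ≤ t → t ≤ R + 2 →
      Jpm p m u (ball 0 s) ≤ Jpm p m u (ball 0 t) := by
    intro s t hst ht
    refine setIntegral_mono_set ((hint t ht).1.add (hint t ht).2)
      (Filter.Eventually.of_forall fun x ↦ ?_) (ball_subset_ball hst).eventuallyLE
    have := energyDensity_nonneg p m hu1 x
    exact add_nonneg this.1 this.2
  have hJ : Jpm p m u (ball 0 R) ≤ c * (ω * (n * 2 ^ (n - 1))) * R ^ (n - 1) := by
    rw [mul_assoc c]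
    refine hiter (fun r ↦ Jpm p m u (ball 0 r)) R (Jpm p m u (ball 0 (R + 1)))
      (ω * (n * 2 ^ (n - 1)) * R ^ (n - 1)) (by positivity)
      (fun s hs ↦ hmono _ _ hs.2 (by linarith)) fun s hs t ht hst ↦ ?_
    have hts : 0 < t - s := sub_pos.2 hst
    have h1 := hmin.energy_ball_le hp0 hm0 hQ0.le hu1 hu hst
      ((closedBall_subset_closedBall (by linarith [ht.2])).trans hRΩ)
    have h2 := hmono s t hst.le (by linarith [ht.2])
    set V := volume.real (ball (0 : EuclideanSpace ℝ (Fin n)) t \ ball 0 s)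
    set N := ω * (n * 2 ^ (n - 1)) * R ^ (n - 1)
    set a := (2 / (t - s)) ^ p + 1
    have ha0 : 0 ≤ a := by positivity
    have hVN : V ≤ N := by
      refine le_trans ?_ (volume_real_annulus_le (by linarith))
      exact measureReal_mono (sdiff_subset_sdiff (ball_subset_ball ht.2) (ball_subset_ball hs.1))
        ((measure_mono sdiff_subset).trans_lt measure_ball_lt_top).ne
    have h3 : Q * (a * V) ≤ Q * (a * N) := by gcongr
    have h4 : 0 ≤ a * N := by positivity
    have h5 : Q / (Q + 1) * Jpm p m u (ball 0 t) + a * N =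
        (Q * Jpm p m u (ball 0 t) + (Q + 1) * (a * N)) / (Q + 1) := by field_simp
    rw [h5, le_div_iff₀ (by positivity)]
    linarith
  refine ⟨hJ, le_trans ?_ hJ⟩
  have hi := hint R (by linarith)
  refine setIntegral_mono hi.2 (hi.1.add hi.2) fun x ↦ ?_
  exact le_add_of_nonneg_left (energyDensity_nonneg p m hu1 x).1
end
end

section
/- There exists a constant C = C(n,p,m) > 0 such that for all real numbers R ≥ T ≥ 1, ∫_{B_{R−T}} ( |∇v_R(x)|^p + (1 − v_R(x)²)^m ) dx ≤ C·R^{n−1}·T^{−γ}, where B_{R−T} is the open ball of radius R−T centered at the origin in ℝ^n. -/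
open MeasureTheory Metric Set

noncomputable section

/-- The one-dimensional profile `U(t) = t` for `t ≥ 0` and
`U(t) = -1 + (1-t)^(-p/(m-p))` for `t ≤ 0`. -/
def Uprof (p m : ℝ) (t : ℝ) : ℝ :=
  if 0 ≤ t then t else -1 + (1 - t) ^ (-(p / (m - p)))

/-- The radial competitor `v_R(x) = U(|x| - R)`. -/
def vComp {n : ℕ} (p m R : ℝ) (x : EuclideanSpace ℝ (Fin n)) : ℝ :=
  Uprof p m (‖x‖ - R)

lemma hasDerivAt_Uprof_of_neg (p m : ℝ) {t : ℝ} (ht : t < 0) :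
    HasDerivAt (Uprof p m) (p / (m - p) * (1 - t) ^ (-(p / (m - p)) - 1)) t := by
  have h1 : HasDerivAt (fun s : ℝ => 1 - s) (-1) t := (hasDerivAt_id t).const_sub 1
  have h2 := (h1.rpow_const (p := -(p / (m - p))) (Or.inl (by linarith))).const_add (-1)
  refine (h2.congr_of_eventuallyEq ?_).congr_deriv (by ring)
  filter_upwards [Iio_mem_nhds ht] with s hs
  exact if_neg (not_le.2 hs)

lemma norm_gradient_comp_norm_le {E : Type*} [NormedAddCommGroup E] [InnerProductSpace ℝ E]
    [CompleteSpace E] {g : ℝ → ℝ} {g' : ℝ} {x : E} (hx : x ≠ 0) (hg : HasDerivAt g g' ‖x‖) :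
    ‖gradient (fun y => g ‖y‖) x‖ ≤ |g'| := by
  have hN : DifferentiableAt ℝ (fun y : E => ‖y‖) x := differentiableAt_id.norm ℝ hx
  have hf : HasFDerivAt (fun y : E => g ‖y‖) (g' • fderiv ℝ (fun y : E => ‖y‖) x) x :=
    hg.comp_hasFDerivAt x hN.hasFDerivAt
  have hle : ‖fderiv ℝ (fun y : E => ‖y‖) x‖ ≤ 1 :=
    NNReal.coe_one ▸ norm_fderiv_le_of_lipschitz ℝ lipschitzWith_one_norm
  rw [gradient, LinearIsometryEquiv.norm_map, hf.fderiv, norm_smul, Real.norm_eq_abs]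
  exact mul_le_of_le_one_right (abs_nonneg _) hle

lemma norm_gradient_vComp_rpow_le {n : ℕ} {p m R : ℝ} (hp : 1 < p) (hpm : p < m)
    {x : EuclideanSpace ℝ (Fin n)} (hx : x ≠ 0) (hxR : ‖x‖ < R) :
    ‖gradient (vComp p m R) x‖ ^ p ≤
      (p / (m - p)) ^ p * (1 + R - ‖x‖) ^ (-(p * m / (m - p))) := by
  have hmp : 0 < m - p := sub_pos.2 hpm
  have hs : 0 < 1 + R - ‖x‖ := by linarith
  have hg : HasDerivAt (fun r => Uprof p m (r - R))
      (p / (m - p) * (1 + R - ‖x‖) ^ (-(p / (m - p)) - 1)) ‖x‖ := by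
    have := (hasDerivAt_Uprof_of_neg p m (sub_neg.2 hxR)).comp_sub_const ‖x‖ R
    rwa [show 1 - (‖x‖ - R) = 1 + R - ‖x‖ by ring] at this
  have hle := norm_gradient_comp_norm_le hx hg
  rw [abs_of_nonneg (by positivity)] at hle
  refine (Real.rpow_le_rpow (norm_nonneg _) hle (by linarith)).trans_eq ?_
  rw [Real.mul_rpow (by positivity) (by positivity), ← Real.rpow_mul hs.le]
  congr 2
  field_simp
  ring

lemma one_sub_vComp_sq_mem {n : ℕ} {p m R : ℝ} (hp : 1 < p) (hpm : p < m)
    {x : EuclideanSpace ℝ (Fin n)} (hxR : ‖x‖ < R) :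
    1 - vComp p m R x ^ 2 ∈ Icc 0 (2 * (1 + R - ‖x‖) ^ (-(p / (m - p)))) := by
  have hmp : 0 < m - p := sub_pos.2 hpm
  have hq : 0 < p / (m - p) := by positivity
  have hv : vComp p m R x = -1 + (1 + R - ‖x‖) ^ (-(p / (m - p))) := by
    rw [vComp, Uprof, if_neg (by linarith), show 1 - (‖x‖ - R) = 1 + R - ‖x‖ by ring]
  have h0 : 0 ≤ (1 + R - ‖x‖) ^ (-(p / (m - p))) := Real.rpow_nonneg (by linarith) _
  have h1 : (1 + R - ‖x‖) ^ (-(p / (m - p))) ≤ 1 :=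
    Real.rpow_le_one_of_one_le_of_nonpos (by linarith) (by linarith)
  rw [hv]
  constructor <;> nlinarith

lemma one_sub_vComp_sq_rpow_le {n : ℕ} {p m R : ℝ} (hp : 1 < p) (hpm : p < m)
    {x : EuclideanSpace ℝ (Fin n)} (hxR : ‖x‖ < R) :
    (1 - vComp p m R x ^ 2) ^ m ≤ 2 ^ m * (1 + R - ‖x‖) ^ (-(p * m / (m - p))) := by
  have hs : 0 < 1 + R - ‖x‖ := by linarith
  obtain ⟨h0, h1⟩ := one_sub_vComp_sq_mem hp hpm hxR
  refine (Real.rpow_le_rpow h0 h1 (by linarith)).trans_eq ?_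
  rw [Real.mul_rpow (by positivity) (by positivity), ← Real.rpow_mul hs.le]
  congr 2
  ring

lemma intervalIntegral_one_add_sub_rpow_le {a R T : ℝ} (ha : 1 < a) (hT : 1 ≤ T) (hTR : T ≤ R) :
    ∫ y in (0 : ℝ)..(R - T), (1 + R - y) ^ (-a) ≤ T ^ (-(a - 1)) / (a - 1) := by
  rw [intervalIntegral.integral_comp_sub_left (fun y => y ^ (-a)), integral_rpow]
  · have h1 : 0 ≤ (1 + R - 0) ^ (-(a - 1)) := Real.rpow_nonneg (by linarith) _
    have h2 : (1 + R - (R - T)) ^ (-(a - 1)) ≤ T ^ (-(a - 1)) :=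
      Real.rpow_le_rpow_of_nonpos (by linarith) (by linarith) (by linarith)
    rw [show -a + 1 = -(a - 1) by ring, div_neg, ← neg_div]
    gcongr
    · linarith
  · refine Or.inr ⟨by linarith, ?_⟩
    rw [uIcc_of_le (by linarith)]
    exact fun h => by linarith [h.1]

lemma integrableOn_ball_one_add_sub_norm_rpow {n : ℕ} {a R T : ℝ} (ha : 0 ≤ a) (hT : 0 ≤ T) :
    IntegrableOn (fun x : EuclideanSpace ℝ (Fin n) => (1 + R - ‖x‖) ^ (-a)) (ball 0 (R - T)) := by
  refine IntegrableOn.of_bound measure_ball_lt_top ?_ 1 ?_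
  · exact (Measurable.pow_const (by fun_prop) _).aestronglyMeasurable
  · refine ae_restrict_of_forall_mem measurableSet_ball fun x hx => ?_
    rw [mem_ball_zero_iff] at hx
    rw [Real.norm_of_nonneg (Real.rpow_nonneg (by linarith) _)]
    exact Real.rpow_le_one_of_one_le_of_nonpos (by linarith) (by linarith)

lemma setIntegral_ball_one_add_sub_norm_rpow_le {n : ℕ} (hn : 2 ≤ n) {a R T : ℝ} (ha : 1 < a)
    (hT : 1 ≤ T) (hTR : T ≤ R) :
    ∫ x in ball (0 : EuclideanSpace ℝ (Fin n)) (R - T), (1 + R - ‖x‖) ^ (-a) ≤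
      n * volume.real (ball (0 : EuclideanSpace ℝ (Fin n)) 1) *
        (R ^ (n - 1) * (T ^ (-(a - 1)) / (a - 1))) := by
  have : Nonempty (Fin n) := ⟨⟨0, by omega⟩⟩
  have hRT : 0 ≤ R - T := by linarith
  have hind : (ball (0 : EuclideanSpace ℝ (Fin n)) (R - T)).indicator
        (fun x => (1 + R - ‖x‖) ^ (-a)) =
      fun x => (Iio (R - T)).indicator (fun y : ℝ => (1 + R - y) ^ (-a)) ‖x‖ := by
    ext x
    simp [indicator]
  have hcont : ContinuousOn (fun y : ℝ => (1 + R - y) ^ (-a)) (uIcc 0 (R - T)) := by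
    rw [uIcc_of_le hRT]
    exact ContinuousOn.rpow_const (by fun_prop) fun y hy => Or.inl (by linarith [hy.2])
  rw [← integral_indicator measurableSet_ball, hind, integral_fun_norm_addHaar volume,
    finrank_euclideanSpace_fin, nsmul_eq_mul, smul_eq_mul, ← mul_assoc]
  gcongr
  have hmul : (fun y : ℝ => y ^ (n - 1) • (Iio (R - T)).indicator (fun z => (1 + R - z) ^ (-a)) y) =
      (Iio (R - T)).indicator (fun y => y ^ (n - 1) * (1 + R - y) ^ (-a)) :=
    funext fun y => (indicator_mul_right _ (fun z : ℝ => z ^ (n - 1)) _).symm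
  calc ∫ y in Ioi (0 : ℝ), y ^ (n - 1) • (Iio (R - T)).indicator (fun z => (1 + R - z) ^ (-a)) y
      = ∫ y in (0 : ℝ)..(R - T), y ^ (n - 1) * (1 + R - y) ^ (-a) := by
        rw [hmul, setIntegral_indicator measurableSet_Iio, Ioi_inter_Iio,
          intervalIntegral.integral_of_le hRT, integral_Ioc_eq_integral_Ioo]
    _ ≤ ∫ y in (0 : ℝ)..(R - T), R ^ (n - 1) * (1 + R - y) ^ (-a) := by
        refine intervalIntegral.integral_mono_on hRT
          (ContinuousOn.mul (by fun_prop) hcont).intervalIntegrable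
          (ContinuousOn.mul (by fun_prop) hcont).intervalIntegrable fun y hy => ?_
        have hs : 0 ≤ (1 + R - y) ^ (-a) := Real.rpow_nonneg (by linarith [hy.2]) _
        gcongr
        · exact hy.1
        · linarith [hy.2]
    _ = R ^ (n - 1) * ∫ y in (0 : ℝ)..(R - T), (1 + R - y) ^ (-a) :=
        intervalIntegral.integral_const_mul _ _
    _ ≤ R ^ (n - 1) * (T ^ (-(a - 1)) / (a - 1)) :=
        mul_le_mul_of_nonneg_left (intervalIntegral_one_add_sub_rpow_le ha hT hTR)
          (pow_nonneg (by linarith) _)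

/-- The energy of the competitor `v_R` in the inner ball `B_{R-T}` decays like
`R^{n-1} T^{-γ}` with `γ = pm/(m-p) - 1 > 0` (estimate (2.15) in the paper). -/
theorem competitor_energy_in_inner_ball
    (n : ℕ) (hn : 2 ≤ n) (p m : ℝ) (hp : 1 < p) (hpm : p < m) :
    ∃ C > (0 : ℝ),
      ∀ R T : ℝ, 1 ≤ T → T ≤ R →
        (∫ x in ball (0 : EuclideanSpace ℝ (Fin n)) (R - T),
            (‖gradient (vComp p m R) x‖ ^ p + (1 - (vComp p m R x) ^ 2) ^ m)) ≤
          C * R ^ (n - 1) * T ^ (-(p * m / (m - p) - 1)) := by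
  have hmp : 0 < m - p := sub_pos.2 hpm
  have ha : 1 < p * m / (m - p) := by
    rw [lt_div_iff₀ hmp]
    nlinarith
  have : Nonempty (Fin n) := ⟨⟨0, by omega⟩⟩
  have hV : 0 < volume.real (ball (0 : EuclideanSpace ℝ (Fin n)) 1) :=
    ENNReal.toReal_pos (measure_ball_pos volume 0 one_pos).ne' measure_ball_lt_top.ne
  have hn0 : (0 : ℝ) < n := by exact_mod_cast (by omega : 0 < n)
  have ha0 : 0 < p * m / (m - p) - 1 := sub_pos.2 ha
  have hK : 0 < (p / (m - p)) ^ p + 2 ^ m := by positivity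
  refine ⟨((p / (m - p)) ^ p + 2 ^ m) *
    (n * volume.real (ball (0 : EuclideanSpace ℝ (Fin n)) 1) / (p * m / (m - p) - 1)),
    by positivity, fun R T hT hTR => ?_⟩
  have hlt : ∀ x ∈ ball (0 : EuclideanSpace ℝ (Fin n)) (R - T), ‖x‖ < R := fun x hx => by
    linarith [mem_ball_zero_iff.1 hx]
  calc ∫ x in ball (0 : EuclideanSpace ℝ (Fin n)) (R - T),
        (‖gradient (vComp p m R) x‖ ^ p + (1 - (vComp p m R x) ^ 2) ^ m)
      ≤ ∫ x in ball (0 : EuclideanSpace ℝ (Fin n)) (R - T),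
        ((p / (m - p)) ^ p + 2 ^ m) * (1 + R - ‖x‖) ^ (-(p * m / (m - p))) := by
        refine integral_mono_of_nonneg ?_ ((integrableOn_ball_one_add_sub_norm_rpow
          (by linarith) (by linarith)).const_mul _) ?_
        · refine ae_restrict_of_forall_mem measurableSet_ball fun x hx => ?_
          exact add_nonneg (Real.rpow_nonneg (norm_nonneg _) _)
            (Real.rpow_nonneg (one_sub_vComp_sq_mem hp hpm (hlt x hx)).1 _)
        · filter_upwards [ae_restrict_mem measurableSet_ball,
            ae_restrict_of_ae ((countable_singleton 0).ae_notMem volume)] with x hx hx0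
          rw [add_mul]
          exact add_le_add (norm_gradient_vComp_rpow_le hp hpm hx0 (hlt x hx))
            (one_sub_vComp_sq_rpow_le hp hpm (hlt x hx))
    _ = ((p / (m - p)) ^ p + 2 ^ m) * ∫ x in ball (0 : EuclideanSpace ℝ (Fin n)) (R - T),
        (1 + R - ‖x‖) ^ (-(p * m / (m - p))) := integral_const_mul _ _
    _ ≤ ((p / (m - p)) ^ p + 2 ^ m) *
        (n * volume.real (ball (0 : EuclideanSpace ℝ (Fin n)) 1) *
          (R ^ (n - 1) * (T ^ (-(p * m / (m - p) - 1)) / (p * m / (m - p) - 1)))) :=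
        mul_le_mul_of_nonneg_left (setIntegral_ball_one_add_sub_norm_rpow_le hn ha hT hTR) hK.le
    _ = _ := by ring
end
end

section
/- Let u be a Q-minimizer of J on Ω. There exists a constant C = C(n,p,m,Q) > 0 such that for all real numbers R ≥ T ≥ 1 with the closure of B_{R+1} contained in Ω, ∫_{U(−T)}^{1} |S_{R,h}|^{(n−1)/n} · W(h)^{(p−1)/p} dh ≤ C · J(v_R, S_R). -/
open MeasureTheory Metric Set

noncomputable section

/-- `S_R = {x ∈ B_{R+1} : u(x) > v_R(x)}`. -/
def Sset {n : ℕ} (p m R : ℝ) (u : EuclideanSpace ℝ (Fin n) → ℝ) :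
    Set (EuclideanSpace ℝ (Fin n)) :=
  {x ∈ ball (0 : EuclideanSpace ℝ (Fin n)) (R + 1) | vComp p m R x < u x}

/-- `S_{R,h} = {x ∈ B_{R+1} : u(x) > h > v_R(x)}`. -/
def Shset {n : ℕ} (p m R h : ℝ) (u : EuclideanSpace ℝ (Fin n) → ℝ) :
    Set (EuclideanSpace ℝ (Fin n)) :=
  {x ∈ ball (0 : EuclideanSpace ℝ (Fin n)) (R + 1) | vComp p m R x < h ∧ h < u x}

open scoped ENNReal NNReal Topology Convolution

section Sobolev

variable {E : Type*} [NormedAddCommGroup E] [NormedSpace ℝ E] [FiniteDimensional ℝ E]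
  [MeasurableSpace E] [BorelSpace E] {μ : Measure E} [μ.IsAddHaarMeasure]

/-- The derivative of a mollified Lipschitz function is the mollified derivative. -/
lemma LipschitzWith.hasFDerivAt_convolution_bump [HasContDiffBump E] {K : ℝ≥0} {φ : E → ℝ}
    (hφ : LipschitzWith K φ) (ρ : ContDiffBump (0 : E)) (x : E) :
    HasFDerivAt (ρ.normed μ ⋆[ContinuousLinearMap.lsmul ℝ ℝ, μ] φ)
      (∫ y, ρ.normed μ y • fderiv ℝ φ (x - y) ∂μ) x := by
  have hcont : ∀ z : E, Continuous fun y => ρ.normed μ y * φ (z - y) := fun z =>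
    ρ.continuous_normed.mul (hφ.continuous.comp (continuous_const.sub continuous_id))
  have hmp : Measure.QuasiMeasurePreserving (fun y => x - y) μ μ :=
    (Measure.measurePreserving_sub_left μ x).quasiMeasurePreserving
  refine (hasFDerivAt_integral_of_dominated_loc_of_lip (μ := μ) (s := univ)
    (F := fun z y => ρ.normed μ y * φ (z - y)) (bound := fun y => ρ.normed μ y * K)
    Filter.univ_mem (.of_forall fun z => (hcont z).aestronglyMeasurable)
    ((hcont x).integrable_of_hasCompactSupport ρ.hasCompactSupport_normed.mul_right)
    ?_ ?_ (ρ.integrable_normed.mul_const _) ?_).2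
  · exact (ρ.continuous_normed.measurable.smul
      ((measurable_fderiv ℝ φ).comp (measurable_const.sub measurable_id))).aestronglyMeasurable
  · refine .of_forall fun y => LipschitzWith.lipschitzOnWith ?_
    refine LipschitzWith.of_dist_le_mul fun a b => ?_
    have h := hφ.dist_le_mul (a - y) (b - y)
    rw [dist_sub_right] at h
    have h0 := ρ.nonneg_normed (μ := μ) y
    rw [Real.coe_nnabs, abs_of_nonneg (by positivity), Real.dist_eq, ← mul_sub, abs_mul,
      abs_of_nonneg h0, mul_assoc]
    exact mul_le_mul_of_nonneg_left h h0
  · filter_upwards [hmp.ae hφ.ae_differentiableAt] with y hy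
    exact ((hasFDerivAt_comp_sub y).2 hy.hasFDerivAt).const_mul _

/-- The `L¹` norm of the derivative of a mollified Lipschitz function does not exceed that of the
function itself. -/
lemma LipschitzWith.lintegral_fderiv_convolution_bump_le [HasContDiffBump E] {K : ℝ≥0} {φ : E → ℝ}
    (hφ : LipschitzWith K φ) (ρ : ContDiffBump (0 : E)) :
    ∫⁻ x, ‖fderiv ℝ (ρ.normed μ ⋆[ContinuousLinearMap.lsmul ℝ ℝ, μ] φ) x‖ₑ ∂μ ≤
      ∫⁻ x, ‖fderiv ℝ φ x‖ₑ ∂μ := by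
  have hρ : Measurable fun y => ‖ρ.normed μ y‖ₑ := ρ.continuous_normed.measurable.enorm
  have hm : Measurable fun z : E × E => ‖fderiv ℝ φ (z.1 - z.2)‖ₑ :=
    ((measurable_fderiv ℝ φ).comp (measurable_fst.sub measurable_snd)).enorm
  have hone : ∫⁻ y, ‖ρ.normed μ y‖ₑ ∂μ = 1 := by
    rw [← ofReal_integral_norm_eq_lintegral_enorm ρ.integrable_normed]
    simp_rw [Real.norm_of_nonneg (ρ.nonneg_normed _), ρ.integral_normed, ENNReal.ofReal_one]
  calc ∫⁻ x, ‖fderiv ℝ (ρ.normed μ ⋆[ContinuousLinearMap.lsmul ℝ ℝ, μ] φ) x‖ₑ ∂μ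
      ≤ ∫⁻ x, ∫⁻ y, ‖ρ.normed μ y‖ₑ * ‖fderiv ℝ φ (x - y)‖ₑ ∂μ ∂μ := by
        refine lintegral_mono fun x => ?_
        rw [(hφ.hasFDerivAt_convolution_bump ρ x).fderiv]
        refine (enorm_integral_le_lintegral_enorm _).trans_eq ?_
        simp_rw [enorm_smul]
    _ = ∫⁻ y, ∫⁻ x, ‖ρ.normed μ y‖ₑ * ‖fderiv ℝ φ (x - y)‖ₑ ∂μ ∂μ :=
        lintegral_lintegral_swap ((hρ.comp measurable_snd).mul hm).aemeasurable
    _ = ∫⁻ y, ‖ρ.normed μ y‖ₑ * ∫⁻ x, ‖fderiv ℝ φ x‖ₑ ∂μ ∂μ := by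
        refine lintegral_congr fun y => ?_
        have hy : Measurable fun x => ‖fderiv ℝ φ (x - y)‖ₑ :=
          ((measurable_fderiv ℝ φ).comp (measurable_id.sub_const y)).enorm
        refine (lintegral_const_mul _ hy).trans (congrArg _ ?_)
        exact lintegral_sub_right_eq_self (fun x => ‖fderiv ℝ φ x‖ₑ) y
    _ = ∫⁻ x, ‖fderiv ℝ φ x‖ₑ ∂μ := by
        rw [lintegral_mul_const _ hρ, hone, one_mul]

/-- The **Gagliardo-Nirenberg-Sobolev inequality** for compactly supported Lipschitz functions. -/
theorem LipschitzWith.lintegral_pow_le_pow_lintegral_fderiv [HasContDiffBump E]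
    {K : ℝ≥0} {φ : E → ℝ} (hφ : LipschitzWith K φ) (hc : HasCompactSupport φ) {q : ℝ}
    (hq : Real.HolderConjugate (Module.finrank ℝ E) q) :
    ∫⁻ x, ‖φ x‖ₑ ^ q ∂μ ≤
      lintegralPowLePowLIntegralFDerivConst μ q * (∫⁻ x, ‖fderiv ℝ φ x‖ₑ ∂μ) ^ q := by
  have hq0 : 0 ≤ q := hq.symm.nonneg
  let ρ : ℕ → ContDiffBump (0 : E) := fun k =>
    ⟨1 / (k + 1 : ℝ) / 2, 1 / (k + 1 : ℝ), by positivity, half_lt_self (by positivity)⟩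
  let ψ : ℕ → E → ℝ := fun k => (ρ k).normed μ ⋆[ContinuousLinearMap.lsmul ℝ ℝ, μ] φ
  have hψ : ∀ k, ContDiff ℝ 1 (ψ k) := fun k =>
    (ρ k).hasCompactSupport_normed.contDiff_convolution_left _ (ρ k).contDiff_normed
      hφ.continuous.locallyIntegrable
  have hlim : ∀ x, Filter.Tendsto (fun k => ‖ψ k x‖ₑ ^ q) Filter.atTop (𝓝 (‖φ x‖ₑ ^ q)) := fun x =>
    ((ENNReal.continuous_rpow_const.comp continuous_enorm).tendsto _).comp
      (ContDiffBump.convolution_tendsto_right_of_continuous (μ := μ) (φ := ρ)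
        tendsto_one_div_add_atTop_nhds_zero_nat hφ.continuous x)
  calc ∫⁻ x, ‖φ x‖ₑ ^ q ∂μ
      = ∫⁻ x, Filter.liminf (fun k => ‖ψ k x‖ₑ ^ q) Filter.atTop ∂μ :=
        lintegral_congr fun x => (hlim x).liminf_eq.symm
    _ ≤ Filter.liminf (fun k => ∫⁻ x, ‖ψ k x‖ₑ ^ q ∂μ) Filter.atTop :=
        lintegral_liminf_le fun k => ((hψ k).continuous.measurable.enorm.pow_const q)
    _ ≤ Filter.liminf (fun _ : ℕ => lintegralPowLePowLIntegralFDerivConst μ q *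
          (∫⁻ x, ‖fderiv ℝ φ x‖ₑ ∂μ) ^ q) Filter.atTop := by
        refine Filter.liminf_le_liminf (.of_forall fun k => ?_)
        refine (MeasureTheory.lintegral_pow_le_pow_lintegral_fderiv μ (hψ k)
          ((ρ k).hasCompactSupport_normed.convolution _ hc) hq).trans ?_
        exact mul_le_mul_right (ENNReal.rpow_le_rpow
          (hφ.lintegral_fderiv_convolution_bump_le (ρ k)) hq0) _
    _ = _ := Filter.liminf_const _

end Sobolev

section Ramp

variable {E : Type*} [NormedAddCommGroup E] [NormedSpace ℝ E]

lemma fderiv_eq_of_eventually_le {f g : E → ℝ} {x : E} (hf : DifferentiableAt ℝ f x)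
    (hg : DifferentiableAt ℝ g x) (hle : ∀ᶠ y in 𝓝 x, f y ≤ g y) (heq : f x = g x) :
    fderiv ℝ f x = fderiv ℝ g x := by
  have hmax : IsLocalMax (f - g) x := by
    filter_upwards [hle] with y hy
    simp only [Pi.sub_apply]
    linarith
  have h := hmax.fderiv_eq_zero
  rwa [fderiv_sub hf hg, sub_eq_zero] at h

/-- A Lipschitz approximation, at scale `ε`, of the indicator function of `{v < h < u}`. -/
def levelRamp (u v : E → ℝ) (h ε : ℝ) (x : E) : ℝ :=
  max 0 (min 1 (min ((u x - h) / ε) ((h - v x) / ε)))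

variable {u v : E → ℝ} {h ε : ℝ}

omit [NormedSpace ℝ E] in
lemma exists_lipschitzWith_levelRamp {Ku Kv : ℝ≥0} (hu : LipschitzWith Ku u)
    (hv : LipschitzWith Kv v) (hε : 0 < ε) : ∃ K, LipschitzWith K (levelRamp u v h ε) := by
  have key : ∀ {K : ℝ≥0} {f : E → ℝ}, LipschitzWith K f →
      LipschitzWith (K / ε.toNNReal) fun x => f x / ε := fun {K f} hf =>
    LipschitzWith.of_dist_le_mul fun x y => by
      rw [Real.dist_eq, ← sub_div, abs_div, abs_of_pos hε, NNReal.coe_div,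
        Real.coe_toNNReal _ hε.le, div_mul_eq_mul_div]
      gcongr
      exact hf.dist_le_mul x y
  have h1 := key (hu.sub (LipschitzWith.const h))
  have h2 := key ((LipschitzWith.const h).sub hv)
  exact ⟨_, (((h1.min h2).const_min 1).const_max 0)⟩

omit [NormedAddCommGroup E] [NormedSpace ℝ E] in
lemma levelRamp_eq_one (hε : 0 < ε) {x : E} (h1 : h + ε ≤ u x) (h2 : v x ≤ h - ε) :
    levelRamp u v h ε x = 1 := by
  have h3 : 1 ≤ (u x - h) / ε := by rw [le_div_iff₀ hε]; linarith
  have h4 : 1 ≤ (h - v x) / ε := by rw [le_div_iff₀ hε]; linarith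
  simp [levelRamp, h3, h4]

omit [NormedAddCommGroup E] [NormedSpace ℝ E] in
lemma lt_of_levelRamp_pos (hε : 0 < ε) {x : E} (hx : 0 < levelRamp u v h ε x) :
    v x < h ∧ h < u x := by
  simp only [levelRamp, lt_max_iff, lt_self_iff_false, false_or, lt_min_iff,
    div_pos_iff_of_pos_right hε, sub_pos] at hx
  exact ⟨hx.2.2, hx.2.1⟩

lemma enorm_fderiv_levelRamp_le (hε : 0 < ε) {x : E} (hu : DifferentiableAt ℝ u x)
    (hv : DifferentiableAt ℝ v x) :
    ‖fderiv ℝ (levelRamp u v h ε) x‖ₑ ≤ ENNReal.ofReal ε⁻¹ *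
      ((if v x < h ∧ h < u x ∧ u x < h + ε then ‖fderiv ℝ u x‖ₑ else 0) +
        (if h < u x ∧ v x < h ∧ h < v x + ε then ‖fderiv ℝ v x‖ₑ else 0)) := by
  by_cases hd : DifferentiableAt ℝ (levelRamp u v h ε) x
  swap
  · rw [fderiv_zero_of_not_differentiableAt hd, ← ofReal_norm, norm_zero,
      ENNReal.ofReal_zero]
    exact zero_le
  by_cases h0 : levelRamp u v h ε x ≤ 0
  · have hmin : IsLocalMin (levelRamp u v h ε) x :=
      .of_forall fun y => h0.trans (le_max_left _ _)
    rw [hmin.fderiv_eq_zero, ← ofReal_norm, norm_zero,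
      ENNReal.ofReal_zero]
    exact zero_le
  by_cases h1 : 1 ≤ levelRamp u v h ε x
  · have hmax : IsLocalMax (levelRamp u v h ε) x :=
      .of_forall fun y => le_trans (max_le zero_le_one (min_le_left _ _)) h1
    rw [hmax.fderiv_eq_zero, ← ofReal_norm, norm_zero,
      ENNReal.ofReal_zero]
    exact zero_le
  push Not at h0 h1
  obtain ⟨hvx, hux⟩ := lt_of_levelRamp_pos hε h0
  have hval : levelRamp u v h ε x = min ((u x - h) / ε) ((h - v x) / ε) := by
    have h2 : levelRamp u v h ε x = min 1 (min ((u x - h) / ε) ((h - v x) / ε)) := by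
      rcases max_choice (0 : ℝ) (min 1 (min ((u x - h) / ε) ((h - v x) / ε))) with h3 | h3
      · exact absurd h3 h0.ne'
      · exact h3
    rcases min_choice (1 : ℝ) (min ((u x - h) / ε) ((h - v x) / ε)) with h3 | h3
    · exact absurd (h2.trans h3) h1.ne
    · exact h2.trans h3
  have hev_u : ∀ᶠ y in 𝓝 x, h < u y := hu.continuousAt.eventually (lt_mem_nhds hux)
  have hev_v : ∀ᶠ y in 𝓝 x, v y < h := hv.continuousAt.eventually (gt_mem_nhds hvx)
  rcases min_choice ((u x - h) / ε) ((h - v x) / ε) with hc | hc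
  · rw [hc] at hval
    have hlt : u x < h + ε := by
      rw [hval, div_lt_one hε] at h1
      linarith
    have hder : HasFDerivAt (fun y => (u y - h) / ε) (ε⁻¹ • fderiv ℝ u x) x := by
      simp only [div_eq_mul_inv]
      exact (hu.hasFDerivAt.sub_const h).mul_const _
    rw [fderiv_eq_of_eventually_le hd hder.differentiableAt ?_ hval, hder.fderiv, enorm_smul,
      Real.enorm_of_nonneg (by positivity), if_pos ⟨hvx, hux, hlt⟩]
    · gcongr
      exact le_self_add
    · filter_upwards [hev_u] with y hy
      exact max_le (div_nonneg (by linarith) hε.le)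
        ((min_le_right _ _).trans (min_le_left _ _))
  · rw [hc] at hval
    have hlt : h < v x + ε := by
      rw [hval, div_lt_one hε] at h1
      linarith
    have hder : HasFDerivAt (fun y => (h - v y) / ε) (ε⁻¹ • -fderiv ℝ v x) x := by
      simp only [div_eq_mul_inv]
      exact (hv.hasFDerivAt.const_sub h).mul_const _
    rw [fderiv_eq_of_eventually_le hd hder.differentiableAt ?_ hval, hder.fderiv, enorm_smul,
      Real.enorm_of_nonneg (by positivity), enorm_neg, if_pos (c := h < u x ∧ _) ⟨hux, hvx, hlt⟩]
    · gcongr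
      exact le_add_self
    · filter_upwards [hev_v] with y hy
      exact max_le (div_nonneg (by linarith) hε.le)
        ((min_le_right _ _).trans (min_le_right _ _))

end Ramp

section Coarea

variable {E : Type*} [NormedAddCommGroup E] [NormedSpace ℝ E] [FiniteDimensional ℝ E]
  [MeasurableSpace E] [BorelSpace E] {μ : Measure E} [μ.IsAddHaarMeasure]
  {u v : E → ℝ} {Ku Kv : ℝ≥0}

/-- Isoperimetric estimate for superlevel sets at scale `ε`. -/
lemma measure_rpow_le_lintegral_fderiv_levelRamp [HasContDiffBump E] (hu : LipschitzWith Ku u)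
    (hv : LipschitzWith Kv v) {h ε : ℝ} (hε : 0 < ε) (hb : Bornology.IsBounded {x | v x < h})
    {q : ℝ} (hq : Real.HolderConjugate (Module.finrank ℝ E) q) :
    μ {x | h + ε ≤ u x ∧ v x ≤ h - ε} ^ (1 / q) ≤
      (lintegralPowLePowLIntegralFDerivConst μ q : ℝ≥0∞) ^ (1 / q) *
        ∫⁻ x, ‖fderiv ℝ (levelRamp u v h ε) x‖ₑ ∂μ := by
  have hq0 : 0 < q := hq.symm.pos
  obtain ⟨K, hK⟩ := exists_lipschitzWith_levelRamp (h := h) hu hv hε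
  have hnn : ∀ x, 0 ≤ levelRamp u v h ε x := fun x => le_max_left _ _
  have hsupp : HasCompactSupport (levelRamp u v h ε) := by
    refine HasCompactSupport.intro (hb.isCompact_closure) fun x hx => ?_
    by_contra hne
    exact hx (subset_closure (lt_of_levelRamp_pos hε ((hnn x).lt_of_ne' hne)).1)
  have hmeas : MeasurableSet {x | h + ε ≤ u x ∧ v x ≤ h - ε} :=
    (measurableSet_le measurable_const hu.continuous.measurable).inter
      (measurableSet_le hv.continuous.measurable measurable_const)
  have hle : μ {x | h + ε ≤ u x ∧ v x ≤ h - ε} ≤ ∫⁻ x, ‖levelRamp u v h ε x‖ₑ ^ q ∂μ := by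
    rw [← lintegral_indicator_one hmeas]
    refine lintegral_mono (indicator_le fun x hx => ?_)
    simp [levelRamp_eq_one hε hx.1 hx.2]
  calc _ ≤ ((lintegralPowLePowLIntegralFDerivConst μ q : ℝ≥0∞) *
        (∫⁻ x, ‖fderiv ℝ (levelRamp u v h ε) x‖ₑ ∂μ) ^ q) ^ (1 / q) :=
        ENNReal.rpow_le_rpow (hle.trans (hK.lintegral_pow_le_pow_lintegral_fderiv hsupp hq))
          (by positivity)
    _ = _ := by
        rw [ENNReal.mul_rpow_of_nonneg _ _ (by positivity), ← ENNReal.rpow_mul,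
          mul_one_div_cancel hq0.ne', ENNReal.rpow_one]

/-- A weight integrated over a window of length `ε` around `t`. -/
lemma lintegral_window_le {w : ℝ → ℝ} {η ε t : ℝ} (hε : 0 < ε) {I : Set ℝ} {P : ℝ → Prop}
    [DecidablePred P] (hI : MeasurableSet I) (hvol : volume I ≤ ENNReal.ofReal ε)
    (hP : ∀ h ∈ Ioo (-1 : ℝ) 1, P h → h ∈ I ∧ w h ≤ w t + η) (c : ℝ≥0∞) :
    ∫⁻ h in Ioo (-1 : ℝ) 1, ENNReal.ofReal (w h) * (ENNReal.ofReal ε⁻¹ * if P h then c else 0) ≤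
      ENNReal.ofReal (w t + η) * c := by
  calc _ ≤ ∫⁻ h in Ioo (-1 : ℝ) 1, I.indicator
        (fun _ => ENNReal.ofReal (w t + η) * (ENNReal.ofReal ε⁻¹ * c)) h := by
        refine setLIntegral_mono' measurableSet_Ioo fun h hh => ?_
        split_ifs with hPh
        · rw [indicator_of_mem (hP h hh hPh).1]
          gcongr
          exact (hP h hh hPh).2
        · simp
    _ ≤ ∫⁻ h, I.indicator (fun _ => ENNReal.ofReal (w t + η) * (ENNReal.ofReal ε⁻¹ * c)) h :=
        setLIntegral_le_lintegral _ _
    _ = ENNReal.ofReal (w t + η) * (ENNReal.ofReal ε⁻¹ * c) * volume I :=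
        lintegral_indicator_const hI _
    _ ≤ ENNReal.ofReal (w t + η) * (ENNReal.ofReal ε⁻¹ * c) * ENNReal.ofReal ε := by gcongr
    _ = ENNReal.ofReal (w t + η) * c * (ENNReal.ofReal ε⁻¹ * ENNReal.ofReal ε) := by ring
    _ = _ := by
        rw [← ENNReal.ofReal_mul (by positivity), inv_mul_cancel₀ hε.ne', ENNReal.ofReal_one,
          mul_one]

/-- Coarea-type estimate for the level ramps at scale `ε`. -/
lemma lintegral_lintegral_fderiv_levelRamp_le (hu : LipschitzWith Ku u) (hv : LipschitzWith Kv v)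
    {w : ℝ → ℝ} (hw : Continuous w) {ε η : ℝ} (hε : 0 < ε)
    (huS : ∀ x, v x < 1 → v x < u x → u x ∈ Icc (-1 : ℝ) 1) (hvS : ∀ x, -1 ≤ v x)
    (hmod : ∀ s ∈ Icc (-1 : ℝ) 1, ∀ t ∈ Icc (-1 : ℝ) 1, |s - t| < ε → w s ≤ w t + η) :
    ∫⁻ h in Ioo (-1 : ℝ) 1, ENNReal.ofReal (w h) *
        ∫⁻ x, ‖fderiv ℝ (levelRamp u v h ε) x‖ₑ ∂μ ≤
      ∫⁻ x in {x | v x < 1 ∧ v x < u x}, (ENNReal.ofReal (w (u x) + η) * ‖fderiv ℝ u x‖ₑ +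
        ENNReal.ofReal (w (v x) + η) * ‖fderiv ℝ v x‖ₑ) ∂μ := by
  classical
  have huc : Measurable fun z : ℝ × E => u z.2 := hu.continuous.measurable.comp measurable_snd
  have hvc : Measurable fun z : ℝ × E => v z.2 := hv.continuous.measurable.comp measurable_snd
  have hdu : Measurable fun x => ‖fderiv ℝ u x‖ₑ := (measurable_fderiv ℝ u).enorm
  have hdv : Measurable fun x => ‖fderiv ℝ v x‖ₑ := (measurable_fderiv ℝ v).enorm
  have hwm : Measurable fun h => ENNReal.ofReal (w h) := hw.measurable.ennreal_ofReal
  let A : ℝ → E → ℝ≥0∞ := fun h x =>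
    if v x < h ∧ h < u x ∧ u x < h + ε then ‖fderiv ℝ u x‖ₑ else 0
  let B : ℝ → E → ℝ≥0∞ := fun h x =>
    if h < u x ∧ v x < h ∧ h < v x + ε then ‖fderiv ℝ v x‖ₑ else 0
  have hA : Measurable fun z : ℝ × E => A z.1 z.2 :=
    Measurable.ite ((measurableSet_lt hvc measurable_fst).inter
      ((measurableSet_lt measurable_fst huc).inter
        (measurableSet_lt huc (measurable_fst.add_const ε)))) (hdu.comp measurable_snd)
      measurable_const
  have hB : Measurable fun z : ℝ × E => B z.1 z.2 :=
    Measurable.ite ((measurableSet_lt measurable_fst huc).inter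
      ((measurableSet_lt hvc measurable_fst).inter
        (measurableSet_lt measurable_fst (hvc.add_const ε)))) (hdv.comp measurable_snd)
      measurable_const
  have hS : MeasurableSet {x | v x < 1 ∧ v x < u x} :=
    (measurableSet_lt hv.continuous.measurable measurable_const).inter
      (measurableSet_lt hv.continuous.measurable hu.continuous.measurable)
  have hF : Measurable fun z : ℝ × E => ENNReal.ofReal (w z.1) *
      (ENNReal.ofReal ε⁻¹ * A z.1 z.2) + ENNReal.ofReal (w z.1) *
      (ENNReal.ofReal ε⁻¹ * B z.1 z.2) :=
    ((hwm.comp measurable_fst).mul (hA.const_mul _)).add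
      ((hwm.comp measurable_fst).mul (hB.const_mul _))
  calc _ ≤ ∫⁻ h in Ioo (-1 : ℝ) 1, ∫⁻ x, ENNReal.ofReal (w h) * (ENNReal.ofReal ε⁻¹ * A h x) +
        ENNReal.ofReal (w h) * (ENNReal.ofReal ε⁻¹ * B h x) ∂μ := by
        refine lintegral_mono fun h => ?_
        rw [← lintegral_const_mul _ (measurable_fderiv ℝ _).enorm]
        refine lintegral_mono_ae ?_
        filter_upwards [hu.ae_differentiableAt, hv.ae_differentiableAt] with x hux hvx
        rw [← mul_add, ← mul_add]
        gcongr
        exact enorm_fderiv_levelRamp_le hε hux hvx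
    _ = ∫⁻ x, (∫⁻ h in Ioo (-1 : ℝ) 1, ENNReal.ofReal (w h) * (ENNReal.ofReal ε⁻¹ * A h x) +
        ENNReal.ofReal (w h) * (ENNReal.ofReal ε⁻¹ * B h x)) ∂μ :=
        lintegral_lintegral_swap hF.aemeasurable
    _ ≤ ∫⁻ x, {x | v x < 1 ∧ v x < u x}.indicator (fun x => ENNReal.ofReal (w (u x) + η) *
        ‖fderiv ℝ u x‖ₑ + ENNReal.ofReal (w (v x) + η) * ‖fderiv ℝ v x‖ₑ) x ∂μ := by
        refine lintegral_mono fun x => ?_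
        by_cases hx : v x < 1 ∧ v x < u x
        · have hux := huS x hx.1 hx.2
          have hAx : Measurable fun h => ENNReal.ofReal (w h) * (ENNReal.ofReal ε⁻¹ * A h x) :=
            hwm.mul ((hA.comp (measurable_id.prodMk measurable_const)).const_mul _)
          rw [indicator_of_mem (s := {x | v x < 1 ∧ v x < u x}) hx, lintegral_add_left hAx]
          refine add_le_add
            (lintegral_window_le hε (I := Ioo (u x - ε) (u x)) measurableSet_Ioo (by simp) ?_ _)
            (lintegral_window_le hε (I := Ioo (v x) (v x + ε)) measurableSet_Ioo (by simp) ?_ _)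
          · rintro h hh ⟨h1, h2, h3⟩
            exact ⟨⟨by linarith, h2⟩, hmod _ (Ioo_subset_Icc_self hh) _ hux
              (by rw [abs_lt]; constructor <;> linarith)⟩
          · rintro h hh ⟨h1, h2, h3⟩
            exact ⟨⟨h2, h3⟩, hmod _ (Ioo_subset_Icc_self hh) _ ⟨hvS x, hx.1.le⟩
              (by rw [abs_lt]; constructor <;> linarith)⟩
        · refine le_of_eq_of_le ?_ zero_le
          refine (setLIntegral_congr_fun measurableSet_Ioo fun h hh => ?_).trans lintegral_zero
          have h1 : A h x = 0 := if_neg fun h1 =>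
            hx ⟨h1.1.trans hh.2, h1.1.trans h1.2.1⟩
          have h2 : B h x = 0 := if_neg fun h1 =>
            hx ⟨h1.2.1.trans hh.2, h1.2.1.trans h1.1⟩
          simp [h1, h2]
    _ = _ := lintegral_indicator hS _

/-- Combination of the coarea formula with the isoperimetric inequality, for the sets
`{v < h < u}`. -/
theorem lintegral_measure_rpow_le [HasContDiffBump E] (hu : LipschitzWith Ku u)
    (hv : LipschitzWith Kv v) (hb : Bornology.IsBounded {x | v x < 1})
    {w : ℝ → ℝ} (hw : Continuous w)
    (huS : ∀ x, v x < 1 → v x < u x → u x ∈ Icc (-1 : ℝ) 1) (hvS : ∀ x, -1 ≤ v x)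
    {q : ℝ} (hq : Real.HolderConjugate (Module.finrank ℝ E) q) :
    ∫⁻ h in Ioo (-1 : ℝ) 1, ENNReal.ofReal (w h) * μ {x | v x < h ∧ h < u x} ^ (1 / q) ≤
      (lintegralPowLePowLIntegralFDerivConst μ q : ℝ≥0∞) ^ (1 / q) *
        ∫⁻ x in {x | v x < 1 ∧ v x < u x}, (ENNReal.ofReal (w (u x)) * ‖fderiv ℝ u x‖ₑ +
          ENNReal.ofReal (w (v x)) * ‖fderiv ℝ v x‖ₑ) ∂μ := by
  have hq0 : 0 < q := hq.symm.pos
  have hum := hu.continuous.measurable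
  have hvm := hv.continuous.measurable
  set C : ℝ≥0∞ := (lintegralPowLePowLIntegralFDerivConst μ q : ℝ≥0∞) ^ (1 / q)
  have hCfin : C ≠ ∞ := ENNReal.rpow_ne_top_of_nonneg (by positivity) ENNReal.coe_ne_top
  set S : Set E := {x | v x < 1 ∧ v x < u x}
  have hSfin : μ S < ∞ := (measure_mono fun x hx => hx.1).trans_lt hb.measure_lt_top
  set X := ∫⁻ x in S, (ENNReal.ofReal (w (u x)) * ‖fderiv ℝ u x‖ₑ +
    ENNReal.ofReal (w (v x)) * ‖fderiv ℝ v x‖ₑ) ∂μ with hX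
  set D : ℝ≥0∞ := (Ku + Kv) * μ S with hD
  have hDfin : D ≠ ∞ := ENNReal.mul_ne_top (by simp) hSfin.ne
  let ε : ℕ → ℝ := fun k => 1 / (k + 1 : ℝ)
  have hε : ∀ k, 0 < ε k := fun k => by positivity
  have hεlim : Filter.Tendsto ε Filter.atTop (𝓝 0) := tendsto_one_div_add_atTop_nhds_zero_nat
  have hεanti : Antitone ε := fun i j hij => by
    simp only [ε]
    gcongr
  let A : ℕ → ℝ → Set E := fun k h => {x | h + ε k ≤ u x ∧ v x ≤ h - ε k}
  have hAlim : ∀ h, Filter.Tendsto (fun k => μ (A k h)) Filter.atTop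
      (𝓝 (μ {x | v x < h ∧ h < u x})) := fun h => by
    have hU : {x | v x < h ∧ h < u x} = ⋃ k, A k h := by
      ext x
      simp only [mem_ofPred_eq, mem_iUnion, A]
      constructor
      · rintro ⟨h1, h2⟩
        obtain ⟨k, hk⟩ := (hεlim.eventually (gt_mem_nhds
          (lt_min (sub_pos.2 h1) (sub_pos.2 h2)))).exists
        rw [lt_min_iff] at hk
        exact ⟨k, by linarith, by linarith⟩
      · rintro ⟨k, h1, h2⟩
        have := hε k
        exact ⟨by linarith, by linarith⟩
    rw [hU]
    refine tendsto_measure_iUnion_atTop fun i j hij x hx => ?_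
    have := hεanti hij
    exact ⟨by linarith [hx.1], by linarith [hx.2]⟩
  have hAmeas : ∀ k, Measurable fun h => μ (A k h) := fun k =>
    measurable_measure_prodMk_left (s := {z : ℝ × E | z.1 + ε k ≤ u z.2 ∧ v z.2 ≤ z.1 - ε k})
      ((measurableSet_le (measurable_fst.add_const _) (hum.comp measurable_snd)).inter
        (measurableSet_le (hvm.comp measurable_snd) (measurable_fst.sub_const _)))
  have hstep : ∀ η : ℝ≥0, 0 < η → ∀ᶠ k in Filter.atTop,
      ∫⁻ h in Ioo (-1 : ℝ) 1, ENNReal.ofReal (w h) * μ (A k h) ^ (1 / q) ≤ C * (X + η * D) := by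
    intro η hη
    have huc : UniformContinuousOn w (Icc (-1 : ℝ) 1) :=
      isCompact_Icc.uniformContinuousOn_of_continuous hw.continuousOn
    obtain ⟨δ, hδ, hmod⟩ := Metric.uniformContinuousOn_iff.1 huc η hη
    filter_upwards [hεlim.eventually (gt_mem_nhds hδ)] with k hk
    have hmod' : ∀ s ∈ Icc (-1 : ℝ) 1, ∀ t ∈ Icc (-1 : ℝ) 1, |s - t| < ε k → w s ≤ w t + η := by
      intro s hs t ht hst
      have := hmod s hs t ht (hst.trans hk)
      rw [Real.dist_eq, abs_lt] at this
      linarith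
    calc _ ≤ ∫⁻ h in Ioo (-1 : ℝ) 1, C * (ENNReal.ofReal (w h) *
          ∫⁻ x, ‖fderiv ℝ (levelRamp u v h (ε k)) x‖ₑ ∂μ) := by
          refine setLIntegral_mono' measurableSet_Ioo fun h hh => ?_
          rw [mul_left_comm]
          gcongr
          exact measure_rpow_le_lintegral_fderiv_levelRamp hu hv (hε k)
            (hb.subset fun x hx => hx.trans hh.2) hq
      _ = C * ∫⁻ h in Ioo (-1 : ℝ) 1, ENNReal.ofReal (w h) *
          ∫⁻ x, ‖fderiv ℝ (levelRamp u v h (ε k)) x‖ₑ ∂μ := lintegral_const_mul' _ _ hCfin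
      _ ≤ C * ∫⁻ x in S, (ENNReal.ofReal (w (u x) + η) * ‖fderiv ℝ u x‖ₑ +
          ENNReal.ofReal (w (v x) + η) * ‖fderiv ℝ v x‖ₑ) ∂μ := by
          gcongr
          exact lintegral_lintegral_fderiv_levelRamp_le hu hv hw (hε k) huS hvS hmod'
      _ ≤ C * ∫⁻ x in S, ((ENNReal.ofReal (w (u x)) * ‖fderiv ℝ u x‖ₑ +
          ENNReal.ofReal (w (v x)) * ‖fderiv ℝ v x‖ₑ) + η * (Ku + Kv)) ∂μ := by
          refine mul_le_mul_right (lintegral_mono fun x => ?_) _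
          have key : ∀ (K : ℝ≥0) (f : E → ℝ), LipschitzWith K f → ∀ t : ℝ,
              ENNReal.ofReal (w t + η) * ‖fderiv ℝ f x‖ₑ ≤
                ENNReal.ofReal (w t) * ‖fderiv ℝ f x‖ₑ + η * K := fun K f hf t => by
            have h1 : ‖fderiv ℝ f x‖ₑ ≤ K := by
              rw [← ofReal_norm, ← ENNReal.ofReal_coe_nnreal]
              exact ENNReal.ofReal_le_ofReal (norm_fderiv_le_of_lipschitz ℝ hf)
            calc _ ≤ (ENNReal.ofReal (w t) + ENNReal.ofReal η) * ‖fderiv ℝ f x‖ₑ := by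
                  gcongr
                  exact ENNReal.ofReal_add_le
              _ ≤ _ := by
                  rw [add_mul, ENNReal.ofReal_coe_nnreal]
                  gcongr
          refine (add_le_add (key Ku u hu (u x)) (key Kv v hv (v x))).trans_eq ?_
          ring
      _ = C * (X + η * D) := by
          rw [lintegral_add_right _ measurable_const, setLIntegral_const, hX, hD, mul_assoc]
  calc _ = ∫⁻ h in Ioo (-1 : ℝ) 1, Filter.liminf
        (fun k => ENNReal.ofReal (w h) * μ (A k h) ^ (1 / q)) Filter.atTop := by
        refine lintegral_congr fun h => (Filter.Tendsto.liminf_eq ?_).symm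
        exact ENNReal.Tendsto.const_mul ((ENNReal.continuous_rpow_const.tendsto _).comp (hAlim h))
          (Or.inr ENNReal.ofReal_ne_top)
    _ ≤ Filter.liminf (fun k => ∫⁻ h in Ioo (-1 : ℝ) 1, ENNReal.ofReal (w h) *
          μ (A k h) ^ (1 / q)) Filter.atTop :=
        lintegral_liminf_le fun k => hw.measurable.ennreal_ofReal.mul ((hAmeas k).pow_const _)
    _ ≤ C * X := by
        have hle : ∀ η : ℝ≥0, 0 < η → Filter.liminf (fun k => ∫⁻ h in Ioo (-1 : ℝ) 1,
            ENNReal.ofReal (w h) * μ (A k h) ^ (1 / q)) Filter.atTop ≤ C * (X + η * D) :=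
          fun η hη => (Filter.liminf_le_liminf (hstep η hη)).trans_eq (Filter.liminf_const _)
        have hlim : Filter.Tendsto (fun η : ℝ≥0 => C * (X + η * D)) (𝓝[>] 0) (𝓝 (C * X)) := by
          have h1 : Filter.Tendsto (fun η : ℝ≥0 => X + (η : ℝ≥0∞) * D) (𝓝[>] 0)
              (𝓝 (X + ((0 : ℝ≥0) : ℝ≥0∞) * D)) :=
            (ENNReal.Tendsto.mul_const ((ENNReal.continuous_coe.tendsto 0).mono_left
              nhdsWithin_le_nhds) (Or.inr hDfin)).const_add X
          simpa using ENNReal.Tendsto.const_mul h1 (Or.inr hCfin)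
        exact ge_of_tendsto hlim (by filter_upwards [self_mem_nhdsWithin] with η hη using hle η hη)

end Coarea

section Profile

variable {p m : ℝ}

lemma exists_lipschitzWith_Uprof (hp : 0 < p) (hpm : p < m) :
    ∃ K, LipschitzWith K (Uprof p m) := by
  set α : ℝ := p / (m - p)
  have hα : 0 < α := div_pos hp (sub_pos.2 hpm)
  have hg : LipschitzOnWith α.toNNReal (fun s : ℝ => -1 + (1 - s) ^ (-α)) (Iic 0) := by
    refine (convex_Iic (0 : ℝ)).lipschitzOnWith_of_nnnorm_hasDerivWithin_le
      (f' := fun s => -1 * -α * (1 - s) ^ (-α - 1)) (fun s hs => ?_) fun s hs => ?_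
    · have hs' : (1 - s) ≠ 0 := by
        have : s ≤ 0 := hs
        linarith
      exact ((((hasDerivAt_id s).const_sub 1).rpow_const (p := -α)
        (Or.inl hs')).const_add (-1)).hasDerivWithinAt
    · have hs' : 1 ≤ 1 - s := by
        have : s ≤ 0 := hs
        linarith
      have h1 : (1 - s) ^ (-α - 1) ≤ 1 := Real.rpow_le_one_of_one_le_of_nonpos hs' (by linarith)
      have h0 : 0 ≤ (1 - s) ^ (-α - 1) := Real.rpow_nonneg (by linarith) _
      rw [← NNReal.coe_le_coe, coe_nnnorm, Real.coe_toNNReal _ hα.le, Real.norm_of_nonneg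
        (by rw [neg_one_mul, neg_neg]; positivity)]
      nlinarith
  have hmin : LipschitzWith 1 fun t : ℝ => min t 0 := LipschitzWith.id.min_const 0
  have hcomp : LipschitzWith (α.toNNReal * 1) fun t : ℝ => -1 + (1 - min t 0) ^ (-α) :=
    lipschitzOnWith_univ.1 (hg.comp (lipschitzOnWith_univ.2 hmin) fun t _ => min_le_right t 0)
  have heq : Uprof p m = fun t => max t 0 + (-1 + (1 - min t 0) ^ (-α)) := by
    ext t
    rcases le_total 0 t with ht | ht
    · simp [Uprof, ht]
    · rcases ht.eq_or_lt with rfl | ht'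
      · simp [Uprof]
      · simp [Uprof, ht, not_le.2 ht', α]
  rw [heq]
  exact ⟨_, (LipschitzWith.id.max_const 0).add hcomp⟩

lemma neg_one_lt_Uprof (t : ℝ) : -1 < Uprof p m t := by
  unfold Uprof
  split_ifs with h
  · linarith
  · have : 0 < (1 - t) ^ (-(p / (m - p))) := Real.rpow_pos_of_pos (by linarith) _
    linarith

lemma lt_one_of_Uprof_lt_one {t : ℝ} (ht : Uprof p m t < 1) : t < 1 := by
  by_contra! h
  rw [Uprof, if_pos (by linarith)] at ht
  linarith

lemma Uprof_le_one_of_nonpos (hp : 0 < p) (hpm : p < m) {t : ℝ} (ht : t ≤ 0) :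
    Uprof p m t ≤ 1 := by
  unfold Uprof
  split_ifs with h
  · linarith
  · have : (1 - t) ^ (-(p / (m - p))) ≤ 1 := Real.rpow_le_one_of_one_le_of_nonpos (by linarith)
      (neg_nonpos.2 (div_pos hp (sub_pos.2 hpm)).le)
    linarith

end Profile

section Energy

variable {n : ℕ} {p m : ℝ}

lemma norm_gradient (f : EuclideanSpace ℝ (Fin n) → ℝ) (x : EuclideanSpace ℝ (Fin n)) :
    ‖gradient f x‖ = ‖fderiv ℝ f x‖ :=
  LinearIsometryEquiv.norm_map _ _

lemma Jpm_congr {f g : EuclideanSpace ℝ (Fin n) → ℝ} {S : Set (EuclideanSpace ℝ (Fin n))}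
    (hS : IsOpen S) (h : EqOn f g S) : Jpm p m f S = Jpm p m g S := by
  refine setIntegral_congr_fun hS.measurableSet fun x hx => ?_
  have h1 : f =ᶠ[𝓝 x] g := Filter.eventuallyEq_of_mem (hS.mem_nhds hx) h
  simp only [norm_gradient, h1.fderiv_eq, h hx]

lemma weight_mul_le_add (hp : 1 < p) {a b : ℝ} (ha : 0 ≤ a) (hb : 0 ≤ b) :
    b ^ ((p - 1) / p) * a ≤ a ^ p + b := by
  have hp0 : 0 < p := by linarith
  have hpq := Real.HolderConjugate.conjExponent hp
  have hY := Real.young_inequality_of_nonneg ha (Real.rpow_nonneg hb ((p - 1) / p)) hpq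
  have h1 : (b ^ ((p - 1) / p)) ^ p.conjExponent = b := by
    rw [← Real.rpow_mul hb, Real.conjExponent, div_mul_div_cancel₀ hp0.ne',
      div_self (by linarith), Real.rpow_one]
  rw [h1] at hY
  have h2 : a ^ p / p ≤ a ^ p := div_le_self (Real.rpow_nonneg ha _) hp.le
  have h3 : b / p.conjExponent ≤ b := div_le_self hb hpq.symm.lt.le
  linarith

lemma lintegral_weight_mul_fderiv_le (hp : 1 < p) (hm : 0 < m) {K : ℝ≥0}
    {f : EuclideanSpace ℝ (Fin n) → ℝ} (hf : LipschitzWith K f)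
    {S : Set (EuclideanSpace ℝ (Fin n))} (hS : MeasurableSet S) (hSfin : volume S < ∞)
    (hfS : ∀ x ∈ S, f x ∈ Icc (-1 : ℝ) 1) :
    ∫⁻ x in S, ENNReal.ofReal (((1 - f x ^ 2) ^ m) ^ ((p - 1) / p)) * ‖fderiv ℝ f x‖ₑ ≤
      ENNReal.ofReal (Jpm p m f S) := by
  have hp0 : 0 < p := by linarith
  have hW : ∀ x ∈ S, 0 ≤ 1 - f x ^ 2 := fun x hx => by
    have := hfS x hx
    nlinarith [this.1, this.2]
  have hmeas : Measurable fun x => ‖gradient f x‖ ^ p + (1 - f x ^ 2) ^ m := by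
    simp only [norm_gradient]
    exact ((measurable_fderiv ℝ f).norm.pow_const p).add
      (((hf.continuous.measurable.pow_const 2).const_sub 1).pow_const m)
  have hint : IntegrableOn (fun x => ‖gradient f x‖ ^ p + (1 - f x ^ 2) ^ m) S := by
    refine IntegrableOn.of_bound (C := (K : ℝ) ^ p + 1) hSfin hmeas.aestronglyMeasurable ?_
    refine (ae_restrict_iff' hS).2 (.of_forall fun x hx => ?_)
    have h0 := hW x hx
    rw [Real.norm_of_nonneg (by positivity), norm_gradient]
    have h1 : ‖fderiv ℝ f x‖ ≤ K := norm_fderiv_le_of_lipschitz ℝ hf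
    refine add_le_add (Real.rpow_le_rpow (norm_nonneg _) h1 hp0.le)
      (Real.rpow_le_one h0 (by nlinarith) hm.le)
  rw [Jpm, ofReal_integral_eq_lintegral_ofReal hint
    ((ae_restrict_iff' hS).2 (.of_forall fun x hx => by have := hW x hx; positivity))]
  refine setLIntegral_mono' hS fun x hx => ?_
  have h0 := hW x hx
  rw [← ofReal_norm, ← ENNReal.ofReal_mul (by positivity), norm_gradient]
  exact ENNReal.ofReal_le_ofReal (weight_mul_le_add hp (norm_nonneg _) (by positivity))

end Energy

/-- The coarea/isoperimetric estimate (2.21) in the paper. -/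
theorem coarea_isoperimetric_estimate
    (n : ℕ) (hn : 2 ≤ n) (p m Q : ℝ)
    (hp : 1 < p) (hpm : p < m) (hQ : 1 ≤ Q) :
    ∃ C > (0 : ℝ),
      ∀ Ω : Set (EuclideanSpace ℝ (Fin n)), IsOpen Ω →
      ∀ u : EuclideanSpace ℝ (Fin n) → ℝ,
        (∀ x, u x ∈ Icc (-1 : ℝ) 1) → LocLipOn Ω u → IsQMinOfJpm p m Q Ω u →
        ∀ R T : ℝ, 1 ≤ T → T ≤ R →
          closure (ball (0 : EuclideanSpace ℝ (Fin n)) (R + 1)) ⊆ Ω →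
          (∫ h in (Uprof p m (-T))..1,
              (volume (Shset p m R h u)).toReal ^ ((n - 1 : ℝ) / n) *
                ((1 - h ^ 2) ^ m) ^ ((p - 1) / p)) ≤
            C * Jpm p m (vComp p m R) (Sset p m R u) := by
  have hp0 : 0 < p := by linarith
  have hm0 : 0 < m := by linarith
  have hn1 : (1 : ℝ) < n := by exact_mod_cast hn
  set q : ℝ := Real.conjExponent n with hqdef
  have hq : Real.HolderConjugate
      (Module.finrank ℝ (EuclideanSpace ℝ (Fin n))) q := by
    rw [finrank_euclideanSpace_fin]
    exact Real.HolderConjugate.conjExponent hn1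
  have hqs : ((n : ℝ) - 1) / n = 1 / q := by rw [hqdef, Real.conjExponent, one_div_div]
  set c : ℝ≥0 := lintegralPowLePowLIntegralFDerivConst
    (volume : Measure (EuclideanSpace ℝ (Fin n))) q ^ (1 / q)
  have hcE : (lintegralPowLePowLIntegralFDerivConst
      (volume : Measure (EuclideanSpace ℝ (Fin n))) q : ℝ≥0∞) ^ (1 / q) = c :=
    ENNReal.coe_rpow_of_nonneg _ (by have := hq.symm.pos; positivity) |>.symm
  refine ⟨c * (Q + 1) + 1, by positivity, fun Ω hΩ u hu01 huL hmin R T hT hTR hR => ?_⟩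
  obtain ⟨KU, hKU⟩ := exists_lipschitzWith_Uprof hp0 hpm
  set v := vComp (n := n) p m R
  have hv : LipschitzWith (KU * (1 + 0)) v :=
    hKU.comp (lipschitzWith_one_norm.sub (LipschitzWith.const R))
  have hv_ball : ∀ x, v x < 1 → x ∈ ball (0 : EuclideanSpace ℝ (Fin n)) (R + 1) := fun x hx => by
    have := lt_one_of_Uprof_lt_one hx
    rw [mem_ball_zero_iff]
    linarith
  have hvS : ∀ x, -1 ≤ v x := fun x => (neg_one_lt_Uprof _).le
  obtain ⟨K, hK⟩ : ∃ K, LipschitzOnWith K u (closedBall 0 (R + 1)) := by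
    refine LocallyLipschitzOn.exists_lipschitzOnWith_of_compact (isCompact_closedBall _ _)
      fun x hx => ?_
    rw [← closure_ball _ (by linarith : R + 1 ≠ 0)] at hx
    obtain ⟨K, U, hU, hKU⟩ := huL x (hR hx)
    exact ⟨K, U, mem_nhdsWithin_of_mem_nhds hU, hKU⟩
  obtain ⟨u', hu', huu⟩ := hK.extend_real
  replace huu : EqOn u u' (ball 0 (R + 1)) := huu.mono ball_subset_closedBall
  have hSeq : Sset p m R u = {x | v x < 1 ∧ v x < u' x} := by
    ext x
    refine ⟨fun hx => ?_, fun hx => ⟨hv_ball x hx.1, ?_⟩⟩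
    · have h1 : v x < u x := hx.2
      exact ⟨h1.trans_le (hu01 x).2, by rwa [← huu hx.1]⟩
    · rw [huu (hv_ball x hx.1)]
      exact hx.2
  have hSh : ∀ h < 1, Shset p m R h u = {x | v x < h ∧ h < u' x} := fun h hh => by
    ext x
    refine ⟨fun hx => ⟨hx.2.1, ?_⟩, fun hx => ⟨hv_ball x (hx.1.trans hh), hx.1, ?_⟩⟩
    · rw [← huu hx.1]
      exact hx.2.2
    · rw [huu (hv_ball x (hx.1.trans hh))]
      exact hx.2
  set S := Sset p m R u
  have hSopen : IsOpen S := by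
    rw [hSeq]
    exact (isOpen_lt hv.continuous continuous_const).inter (isOpen_lt hv.continuous hu'.continuous)
  have hSball : S ⊆ ball 0 (R + 1) := fun x hx => hx.1
  have hSfin : volume S < ∞ := (measure_mono hSball).trans_lt measure_ball_lt_top
  have huS' : ∀ x ∈ S, u' x ∈ Icc (-1 : ℝ) 1 := fun x hx => by
    rw [← huu (hSball hx)]
    exact hu01 x
  have hvS' : ∀ x ∈ S, v x ∈ Icc (-1 : ℝ) 1 := fun x hx =>
    ⟨hvS x, ((show v x < u x from hx.2).trans_le (hu01 x).2).le⟩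
  have hJ : Jpm p m u' S ≤ Q * Jpm p m v S := by
    have h := hmin S hSopen (isBounded_ball.subset hSball)
      ((closure_mono hSball).trans hR) (fun x => min (u x) (v x))
      (fun x => ⟨le_min (hu01 x).1 (hvS x), (min_le_left _ _).trans (hu01 x).2⟩) ?_ ?_
    · rwa [Jpm_congr hSopen (huu.mono hSball),
        Jpm_congr (f := fun x => min (u x) (v x)) (g := v) hSopen fun x hx =>
          min_eq_right (show v x < u x from hx.2).le] at h
    · intro x hx
      obtain ⟨K₁, U, hU, hK₁⟩ := huL x hx
      refine ⟨max K₁ (KU * (1 + 0)), U, hU, ?_⟩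
      have h := lipschitzWith_min.comp_lipschitzOnWith (hK₁.prodMk (hv.lipschitzOnWith (s := U)))
      simpa [Function.comp_def] using h
    · rintro x ⟨-, hx⟩
      refine min_eq_left ?_
      by_contra! hlt
      exact hx ⟨hv_ball x (hlt.trans_le (hu01 x).2), hlt⟩
  have hJv : 0 ≤ Jpm p m v S := by
    refine setIntegral_nonneg hSopen.measurableSet fun x hx => ?_
    have h1 := hvS' x hx
    have h2 : 0 ≤ 1 - v x ^ 2 := by nlinarith [h1.1, h1.2]
    positivity
  let w : ℝ → ℝ := fun h => ((1 - h ^ 2) ^ m) ^ ((p - 1) / p)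
  have hw : Continuous w :=
    ((continuous_const.sub (continuous_pow 2)).rpow_const fun _ => Or.inr hm0.le).rpow_const
      fun _ => Or.inr (div_nonneg (by linarith) hp0.le)
  have hmain := lintegral_measure_rpow_le (μ := volume) hu' hv
    (isBounded_ball.subset hv_ball) hw (fun x h1 h2 => huS' x (hSeq ▸ ⟨h1, h2⟩)) hvS hq
  rw [← hSeq, hcE] at hmain
  have hsum : ∫⁻ x in S, (ENNReal.ofReal (w (u' x)) * ‖fderiv ℝ u' x‖ₑ +
      ENNReal.ofReal (w (v x)) * ‖fderiv ℝ v x‖ₑ) ≤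
      ENNReal.ofReal ((Q + 1) * Jpm p m v S) := by
    have hmeas : Measurable fun x => ENNReal.ofReal (w (u' x)) * ‖fderiv ℝ u' x‖ₑ :=
      (hw.comp hu'.continuous).measurable.ennreal_ofReal.mul (measurable_fderiv ℝ u').enorm
    rw [lintegral_add_left hmeas, add_mul, one_mul, ENNReal.ofReal_add (by positivity) hJv]
    exact add_le_add ((lintegral_weight_mul_fderiv_le hp hm0 hu' hSopen.measurableSet hSfin
      huS').trans (ENNReal.ofReal_le_ofReal hJ))
      (lintegral_weight_mul_fderiv_le hp hm0 hv hSopen.measurableSet hSfin hvS')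
  rw [intervalIntegral.integral_of_le (Uprof_le_one_of_nonpos hp0 hpm (by linarith)),
    integral_Ioc_eq_integral_Ioo, hqs]
  refine (ENNReal.ofReal_le_ofReal_iff (by positivity)).1 ?_
  calc _ ≤ ‖∫ h in Ioo (Uprof p m (-T)) 1, (volume (Shset p m R h u)).toReal ^ (1 / q) * w h‖ₑ :=
        Real.ofReal_le_enorm _
    _ ≤ ∫⁻ h in Ioo (Uprof p m (-T)) 1,
          ‖(volume (Shset p m R h u)).toReal ^ (1 / q) * w h‖ₑ :=
        enorm_integral_le_lintegral_enorm _
    _ ≤ ∫⁻ h in Ioo (-1 : ℝ) 1,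
          ‖(volume (Shset p m R h u)).toReal ^ (1 / q) * w h‖ₑ :=
        lintegral_mono_set (Ioo_subset_Ioo_left (neg_one_lt_Uprof _).le)
    _ ≤ ∫⁻ h in Ioo (-1 : ℝ) 1,
          ENNReal.ofReal (w h) * volume {x | v x < h ∧ h < u' x} ^ (1 / q) := by
        refine setLIntegral_mono' measurableSet_Ioo fun h hh => ?_
        have hq0 : 0 ≤ 1 / q := by have := hq.symm.pos; positivity
        have h0 : 0 ≤ 1 - h ^ 2 := by nlinarith [hh.1, hh.2]
        have hw0 : 0 ≤ w h := Real.rpow_nonneg (Real.rpow_nonneg h0 _) _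
        rw [hSh h hh.2, enorm_mul, mul_comm, Real.enorm_of_nonneg hw0,
          Real.enorm_of_nonneg (by positivity),
          ← ENNReal.ofReal_rpow_of_nonneg ENNReal.toReal_nonneg hq0]
        gcongr
        exact ENNReal.ofReal_toReal_le
    _ ≤ c * ENNReal.ofReal ((Q + 1) * Jpm p m v S) := hmain.trans (by gcongr)
    _ = ENNReal.ofReal (c * ((Q + 1) * Jpm p m v S)) := by
        rw [ENNReal.ofReal_mul c.coe_nonneg, ENNReal.ofReal_coe_nnreal]
    _ ≤ _ := ENNReal.ofReal_le_ofReal (by nlinarith)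
end
end
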